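/- Let f, h be real, smooth, compactly supported functions on ℝ³ with supp(f) ∪ supp(h) ⊆ X for a compact set X, fix t₁ > 0, set ψ = K_{t₁}(f,h), and define u(t,x⃗) = (2π)^{−3/2}·∫_{ℝ³} e^{i k⃗·x⃗}·[v(t,|k⃗|)·ψ(k⃗) + conj(v(t,|k⃗|))·conj(ψ(−k⃗))] dk⃗. Then the solution propagates at unit coordinate speed: for every t₂ > 0 and every y⃗ ∈ ℝ³ with dist(y⃗, X) > |t₂ − t₁|, one has u(t₂, y⃗) = 0. -/

import Mathlib

open Complex MeasureTheory Filter
open scoped RealInnerProductSpace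

noncomputable section

/-- Three-dimensional Euclidean space. -/
abbrev V3 : Type := EuclideanSpace ℝ (Fin 3)

/-- The Bessel function of complex order `α`:
`J_α(x) = Σ_{n=0}^∞ ((−1)^n/(n!·Γ(α+n+1)))·exp((α+2n)·log(x/2))`. -/
def besselJ (α : ℂ) (x : ℝ) : ℂ :=
  ∑' n : ℕ, ((-1 : ℂ) ^ n / ((n.factorial : ℂ) * Complex.Gamma (α + (n : ℂ) + 1))) *
    Complex.exp ((α + 2 * (n : ℂ)) * (Real.log (x / 2) : ℂ))

/-- The Hankel function of the first kind. -/
def hankel1 (α : ℂ) (x : ℝ) : ℂ :=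
  (besselJ (-α) x - Complex.exp (-(Complex.I * (Real.pi : ℂ) * α)) * besselJ α x) /
    (Complex.I * Complex.sin (α * (Real.pi : ℂ)))

/-- The Hankel function of the second kind. -/
def hankel2 (α : ℂ) (x : ℝ) : ℂ :=
  (Complex.exp (Complex.I * (Real.pi : ℂ) * α) * besselJ α x - besselJ (-α) x) /
    (Complex.I * Complex.sin (α * (Real.pi : ℂ)))

/-- `μ = √((mR)² − 9/4)`. -/
def modeMu (m R : ℝ) : ℝ := Real.sqrt ((m * R) ^ 2 - 9 / 4)

/-- `ν = iμ`. -/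
def modeNu (m R : ℝ) : ℂ := Complex.I * (modeMu m R : ℂ)

/-- The mode function `v(t,k) = e^{−μπ/2}·t^{3/2}·H^{(1)}_ν(kt)`. -/
def modeV (m R t k : ℝ) : ℂ :=
  (Real.exp (-(modeMu m R * Real.pi / 2)) : ℂ) * ((t ^ ((3 : ℝ) / 2) : ℝ) : ℂ) *
    hankel1 (modeNu m R) (k * t)

/-- `v′(t,k) = ∂v/∂t (t,k)`. -/
def modeV' (m R t k : ℝ) : ℂ := deriv (fun s => modeV m R s k) t

/-- `ω(k) = √(1+k²)`. -/
def omegaK (k : ℝ) : ℝ := Real.sqrt (1 + k ^ 2)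

/-- The Fourier transform on `ℝ³`. -/
def ft (g : V3 → ℂ) (k : V3) : ℂ :=
  (((2 * Real.pi) ^ (-(3 : ℝ) / 2) : ℝ) : ℂ) *
    ∫ x : V3, Complex.exp (-(Complex.I) * (⟪k, x⟫ : ℂ)) * g x

/-- The inverse Fourier transform on `ℝ³`. -/
def ift (g : V3 → ℂ) (x : V3) : ℂ :=
  (((2 * Real.pi) ^ (-(3 : ℝ) / 2) : ℝ) : ℂ) *
    ∫ k : V3, Complex.exp (Complex.I * (⟪k, x⟫ : ℂ)) * g k

/-- The map `K_t` on the Fourier side, applied to the Fourier transforms `f̃, h̃`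
of the Cauchy data:
`K_t(f,h)(k) = (πi/(4t³))·[t·f̃(k)·conj(v′(t,|k|)) − R·h̃(k)·conj(v(t,|k|))]`. -/
def ktAux (m R t : ℝ) (ftil htil : V3 → ℂ) (k : V3) : ℂ :=
  ((Real.pi : ℂ) * Complex.I / (4 * (t : ℂ) ^ 3)) *
    ((t : ℂ) * ftil k * (starRingEnd ℂ) (modeV' m R t ‖k‖) -
      (R : ℂ) * htil k * (starRingEnd ℂ) (modeV m R t ‖k‖))

/-- `K_t` applied to real Cauchy data `(f,h)`. -/
def ktFun (m R t : ℝ) (f h : V3 → ℝ) : V3 → ℂ :=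
  ktAux m R t (ft fun x => (f x : ℂ)) (ft fun x => (h x : ℂ))

/-- The Fourier transform of the first component of the pair `L_tψ`:
`f̃_t(k) = v(t,|k|)·ψ(k) + conj(v(t,|k|))·conj(ψ(−k))`. -/
def ltF (m R t : ℝ) (ψ : V3 → ℂ) (k : V3) : ℂ :=
  modeV m R t ‖k‖ * ψ k + (starRingEnd ℂ) (modeV m R t ‖k‖) * (starRingEnd ℂ) (ψ (-k))

/-- The Fourier transform of the second component of the pair `L_tψ`:
`h̃_t(k) = (t/R)·[v′(t,|k|)·ψ(k) + conj(v′(t,|k|))·conj(ψ(−k))]`. -/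
def ltH (m R t : ℝ) (ψ : V3 → ℂ) (k : V3) : ℂ :=
  ((t / R : ℝ) : ℂ) *
    (modeV' m R t ‖k‖ * ψ k + (starRingEnd ℂ) (modeV' m R t ‖k‖) * (starRingEnd ℂ) (ψ (-k)))

/-- The solution `u(t,x⃗)` built from the coefficient function `ψ`:
`u(t,x⃗) = (2π)^{−3/2}·∫ e^{ik⃗·x⃗}·[v(t,|k⃗|)·ψ(k⃗) + conj(v(t,|k⃗|))·conj(ψ(−k⃗))] dk⃗`. -/
def uSol (m R : ℝ) (ψ : V3 → ℂ) (t : ℝ) (x : V3) : ℂ :=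
  (((2 * Real.pi) ^ (-(3 : ℝ) / 2) : ℝ) : ℂ) *
    ∫ k : V3, Complex.exp (Complex.I * (⟪k, x⟫ : ℂ)) *
      (modeV m R t ‖k‖ * ψ k + (starRingEnd ℂ) (modeV m R t ‖k‖) * (starRingEnd ℂ) (ψ (-k)))

/-- The spatial Laplacian, as the sum of the second partial derivatives along
the coordinate directions. -/
def lap3 (w : V3 → ℂ) (x : V3) : ℂ :=
  ∑ i : Fin 3, iteratedDeriv 2 (fun s : ℝ => w (x + s • EuclideanSpace.single i (1 : ℝ))) 0

/-- The square of the Sobolev-type norm `‖(f,h)‖_{1/2}`, expressed in terms of the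
Fourier transforms `f̃, h̃` of the data:
`‖(f,h)‖_{1/2}² = ∫ ω(|k⃗|)·|f̃(k⃗)|² dk⃗ + ∫ ω(|k⃗|)⁻¹·|h̃(k⃗)|² dk⃗`. -/
def halfNormSq (ftil htil : V3 → ℂ) : ℝ :=
  (∫ k : V3, omegaK ‖k‖ * ‖ftil k‖ ^ 2) + ∫ k : V3, (omegaK ‖k‖)⁻¹ * ‖htil k‖ ^ 2

/-- The Sobolev-type norm `‖(f,h)‖_{1/2}` (arguments are the Fourier transforms). -/
def halfNorm (ftil htil : V3 → ℂ) : ℝ := Real.sqrt (halfNormSq ftil htil)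

/-- The `L²(ℝ³)` norm. -/
def l2Norm (g : V3 → ℂ) : ℝ := Real.sqrt (∫ k : V3, ‖g k‖ ^ 2)

/-- The transformed potential operator `V̂` with (Fourier-transformed) potential `W`:
`(V̂ψ)(k⃗) = −(2π)^{3/2}·R·(πi/4)·conj(v(1,|k⃗|))·(W ∗ g_ψ)(k⃗)` where
`g_ψ(k⃗) = v(1,|k⃗|)·ψ(k⃗) + conj(v(1,|k⃗|))·conj(ψ(−k⃗))`. -/
def vHatOp (m R : ℝ) (W : V3 → ℂ) (ψ : V3 → ℂ) (k : V3) : ℂ :=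
  ((-((2 * Real.pi) ^ ((3 : ℝ) / 2)) * R : ℝ) : ℂ) * ((Real.pi : ℂ) * Complex.I / 4) *
    (starRingEnd ℂ) (modeV m R 1 ‖k‖) * ∫ y : V3, W y * ltF m R 1 ψ (k - y)

/-- The free transformed evolution `Û₀(a,b) = K₁ ∘ L_a ∘ K_b ∘ L₁` on `L²(ℝ³)`. -/
def u0Hat (m R a b : ℝ) (ψ : V3 → ℂ) : V3 → ℂ :=
  ktAux m R 1 (ltF m R a (ktAux m R b (ltF m R 1 ψ) (ltH m R 1 ψ)))
    (ltH m R a (ktAux m R b (ltF m R 1 ψ) (ltH m R 1 ψ)))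

/-- The inner chain `V̂(s)·V̂(s₂)···V̂(s_{j+1})·Û₀(s_{j+1},1)ψ` of the `n`-th Dyson term,
with the nested integrals `∫₁^{s}···` built in; `W s` is the spatial Fourier transform
of the potential at time `s`. -/
def dysonM (m R : ℝ) (W : ℝ → V3 → ℂ) : ℕ → ℝ → (V3 → ℂ) → V3 → ℂ
  | 0, s, ψ => vHatOp m R (W s) (u0Hat m R s 1 ψ)
  | j + 1, s, ψ => vHatOp m R (W s) fun k => ∫ r in Set.Ioc (1 : ℝ) s, dysonM m R W j r ψ k

/-- The `n`-th Dyson term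
`∫₁^t∫₁^{s₁}···∫₁^{s_{n−1}} Û₀(t,s₁)·V̂(s₁)···V̂(s_n)·Û₀(s_n,1)ψ ds_n···ds₁` (for `n ≥ 1`). -/
def dysonT (m R : ℝ) (W : ℝ → V3 → ℂ) (n : ℕ) (t : ℝ) (ψ : V3 → ℂ) : V3 → ℂ := fun k =>
  ∫ s in Set.Ioc (1 : ℝ) t, u0Hat m R t s (dysonM m R W (n - 1) s ψ) k

def phiC (α : ℂ) (n : ℕ) : ℂ := (-1 : ℂ) ^ n / ((n.factorial : ℂ) * Complex.Gamma (α + (n : ℂ) + 1))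

def phiB (α z : ℂ) : ℂ := ∑' n : ℕ, phiC α n * z ^ n

lemma phiC_shift (α : ℂ) (n : ℕ) : ((n : ℂ) + 1) * phiC α (n + 1) = - phiC (α + 1) n := by
  unfold phiC
  have h1 : (n.factorial : ℂ) ≠ 0 := by exact_mod_cast n.factorial_ne_zero
  have h2 : ((n : ℂ) + 1) ≠ 0 := by exact_mod_cast n.succ_ne_zero
  rw [Nat.factorial_succ]
  push_cast
  rw [show α + ((n : ℂ) + 1) + 1 = α + 1 + n + 1 by ring]
  rw [pow_succ]
  by_cases hG : Complex.Gamma (α + 1 + n + 1) = 0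
  · simp [hG]
  · field_simp

lemma phiC_gamma (α : ℂ) (n : ℕ) : phiC α n = (α + n + 1) * phiC (α + 1) n := by
  unfold phiC
  have := Complex.one_div_Gamma_eq_self_mul_one_div_Gamma_add_one (α + n + 1)
  rw [div_eq_mul_inv, div_eq_mul_inv, mul_inv, mul_inv, this]
  rw [show α + 1 + (n : ℂ) + 1 = α + n + 1 + 1 by ring]
  ring

lemma phiC_summable (α : ℂ) (ρ : ℝ) (hρ : 0 ≤ ρ) : Summable fun n => ‖phiC α n‖ * ρ ^ n := by
  apply summable_of_ratio_norm_eventually_le (r := 1 / 2) (by norm_num)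
  obtain ⟨N, hN⟩ := exists_nat_gt (2 * ρ + ‖α‖ + 1)
  filter_upwards [eventually_ge_atTop N] with n hn
  have hn' : (N : ℝ) ≤ n := by exact_mod_cast hn
  have h1 := phiC_shift α n
  have h2 := phiC_gamma α n
  have h3 : ((n : ℂ) + 1) * (α + n + 1) * phiC α (n + 1) = - phiC α n := by
    rw [h2]; linear_combination (α + n + 1) * h1
  have h4 : ((n : ℝ) + 1) * ‖α + n + 1‖ * ‖phiC α (n + 1)‖ = ‖phiC α n‖ := by
    rw [← norm_neg (phiC α n), ← h3, norm_mul, norm_mul]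
    congr 2
    rw [show ((n : ℂ) + 1) = ((n + 1 : ℕ) : ℂ) by push_cast; ring, Complex.norm_natCast]
    push_cast; ring
  have h5 : (1 : ℝ) ≤ ‖α + n + 1‖ := by
    have : ‖((n + 1 : ℕ) : ℂ)‖ ≤ ‖α + n + 1‖ + ‖α‖ := by
      have := norm_sub_le (α + n + 1) α
      rwa [show α + n + 1 - α = ((n + 1 : ℕ) : ℂ) by push_cast; ring] at this
    rw [Complex.norm_natCast] at this
    push_cast at this
    linarith
  have h6 : 2 * ρ ≤ (n : ℝ) + 1 := by linarith [norm_nonneg α]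
  rw [norm_mul, norm_mul, norm_norm, norm_norm, norm_pow, norm_pow, Real.norm_of_nonneg hρ, pow_succ, ← h4]
  have h7 : 2 * ρ ≤ ((n : ℝ) + 1) * ‖α + n + 1‖ := by nlinarith
  have h8 : 0 ≤ ‖phiC α (n + 1)‖ * ρ ^ n := by positivity
  nlinarith

lemma phiC_summable' (α z : ℂ) : Summable fun n => phiC α n * z ^ n := by
  apply Summable.of_norm
  simpa using phiC_summable α ‖z‖ (norm_nonneg z)

lemma phiB_hasDerivAt (α z : ℂ) : HasDerivAt (phiB α) (-phiB (α + 1) z) z := by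
  set ρ : ℝ := ‖z‖ + 1 with hρ
  have hρ0 : 0 ≤ ρ := by positivity
  have key := hasDerivAt_tsum_of_isPreconnected (𝕜 := ℂ)
    (u := fun n => Nat.casesOn n 0 (fun n => ‖phiC (α + 1) n‖ * ρ ^ n))
    (t := Metric.ball (0 : ℂ) ρ)
    (g := fun n z => phiC α n * z ^ n)
    (g' := fun n z => Nat.casesOn n 0 (fun n => - phiC (α + 1) n * z ^ n)) (y₀ := 0) (y := z)
    ((summable_nat_add_iff 1).1 (phiC_summable (α + 1) ρ hρ0)) Metric.isOpen_ball
    (convex_ball _ _).isPreconnected ?_ ?_ (by simp; positivity) (phiC_summable' α 0)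
    (by simp [hρ])
  · refine HasDerivAt.congr_deriv (f := phiB α) key ?_
    rw [Summable.tsum_eq_zero_add]
    · simp only [phiB]
      rw [← tsum_neg]; refine (zero_add _).trans (tsum_congr fun n => ?_); ring
    · apply (summable_nat_add_iff 1).1
      simpa using (phiC_summable' (α + 1) z).neg
  · intro n y _
    cases n with
    | zero => simpa using hasDerivAt_const y (phiC α 0)
    | succ n =>
      have := (hasDerivAt_pow (n + 1) y).const_mul (phiC α (n + 1))
      refine this.congr_deriv ?_
      simp only [← phiC_shift]; push_cast; ring
  · intro n y hy
    cases n with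
    | zero => simp
    | succ n =>
      simp only [norm_mul, norm_neg, norm_pow]
      have : ‖y‖ ≤ ρ := by simpa using (Metric.mem_ball.1 hy).le
      gcongr

lemma phiB_rec (α z : ℂ) : phiB α z = (α + 1) * phiB (α + 1) z - z * phiB (α + 2) z := by
  have h0 : ∀ n, phiC α n * z ^ n = (α + 1) * (phiC (α + 1) n * z ^ n) + (n : ℂ) * phiC (α + 1) n * z ^ n := by
    intro n; rw [phiC_gamma]; ring
  have hs : Summable fun n : ℕ => (n : ℂ) * phiC (α + 1) n * z ^ n := by
    have := (phiC_summable' α z).sub ((phiC_summable' (α + 1) z).mul_left (α + 1))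
    refine this.congr fun n => ?_
    rw [h0]; ring
  have e : ∀ n : ℕ, ((n + 1 : ℕ) : ℂ) * phiC (α + 1) (n + 1) * z ^ (n + 1) = (-z) * (phiC (α + 2) n * z ^ n) := by
    intro n
    push_cast
    rw [phiC_shift, show α + 1 + 1 = α + 2 by ring]; ring
  unfold phiB
  rw [tsum_congr h0, Summable.tsum_add ((phiC_summable' (α + 1) z).mul_left (α + 1)) hs, tsum_mul_left,
    Summable.tsum_eq_zero_add hs, tsum_congr e, tsum_mul_left]
  push_cast
  ring

/-- Explicit form of the Bessel function. -/
lemma besselJ_eq (α : ℂ) (x : ℝ) : besselJ α x =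
    Complex.exp (α * (Real.log (x / 2) : ℂ)) * phiB α (Complex.exp (2 * (Real.log (x / 2) : ℂ))) := by
  unfold besselJ phiB
  rw [← tsum_mul_left]
  congr 1; ext n
  rw [show phiC α n = (-1 : ℂ) ^ n / ((n.factorial : ℂ) * Complex.Gamma (α + (n : ℂ) + 1)) from rfl,
    add_mul, Complex.exp_add, ← Complex.exp_nat_mul]
  rw [show (n : ℂ) * (2 * (Real.log (x / 2) : ℂ)) = 2 * n * (Real.log (x / 2) : ℂ) by ring]
  ring

def besselD (α : ℂ) (x : ℝ) : ℂ :=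
  (1 / (x : ℂ)) * (Complex.exp (α * (Real.log (x / 2) : ℂ))) *
   (α * phiB α (Complex.exp (2 * (Real.log (x / 2) : ℂ))) 
     - 2 * (Complex.exp (2 * (Real.log (x / 2) : ℂ))) * phiB (α + 1) (Complex.exp (2 * (Real.log (x / 2) : ℂ))))

lemma hasDerivAt_clog (x : ℝ) (hx : 0 < x) :
    HasDerivAt (fun x : ℝ => (Real.log (x / 2) : ℂ)) (1 / (x : ℂ)) x := by
  have h : HasDerivAt (fun x : ℝ => Real.log (x / 2)) (1 / x) x := by
    have := ((hasDerivAt_id x).div_const 2).log (by simp; positivity)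
    refine this.congr_deriv ?_
    simp only [id]; field_simp
  simpa using h.ofReal_comp

lemma exp_two_log (x : ℝ) (hx : 0 < x) : Complex.exp (2 * (Real.log (x / 2) : ℂ)) = (x : ℂ) ^ 2 / 4 := by
  rw [two_mul, Complex.exp_add, ← Complex.ofReal_exp, Real.exp_log (by positivity)]
  push_cast; ring

lemma hasDerivAt_phi (α : ℂ) (x : ℝ) (hx : 0 < x) :
    HasDerivAt (fun x : ℝ => phiB α (Complex.exp (2 * (Real.log (x / 2) : ℂ))))
      (-(2 / (x : ℂ)) * (Complex.exp (2 * (Real.log (x / 2) : ℂ))) * phiB (α + 1) (Complex.exp (2 * (Real.log (x / 2) : ℂ)))) x := by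
  have h1 := ((hasDerivAt_clog x hx).const_mul 2).cexp
  have := (phiB_hasDerivAt α (Complex.exp (2 * (Real.log (x / 2) : ℂ)))).comp x h1
  refine HasDerivAt.congr_deriv (f := fun x : ℝ => phiB α (Complex.exp (2 * (Real.log (x / 2) : ℂ)))) this ?_
  ring

lemma besselJ_hasDerivAt (α : ℂ) (x : ℝ) (hx : 0 < x) : HasDerivAt (besselJ α) (besselD α x) x := by
  rw [show besselJ α = fun x => _ from funext (besselJ_eq α)]
  have h1 := ((hasDerivAt_clog x hx).const_mul α).cexp
  refine (h1.mul (hasDerivAt_phi α x hx)).congr_deriv ?_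
  unfold besselD
  ring

lemma besselD_hasDerivAt (α : ℂ) (x : ℝ) (hx : 0 < x) : HasDerivAt (besselD α)
    (-(1 / (x : ℂ)) * besselD α x - (1 - α ^ 2 / (x : ℂ) ^ 2) * besselJ α x) x := by
  have hx' : (x : ℂ) ≠ 0 := by exact_mod_cast hx.ne'
  have h0 : HasDerivAt (fun x : ℝ => 1 / (x : ℂ)) (-1 / (x : ℂ) ^ 2) x := by
    have := (hasDerivAt_inv hx.ne').ofReal_comp
    refine (this.congr_deriv (by push_cast; ring)).congr_of_eventuallyEq ?_
    exact Eventually.of_forall fun y => by simp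
  have h1 := ((hasDerivAt_clog x hx).const_mul α).cexp
  have h2 := ((hasDerivAt_clog x hx).const_mul 2).cexp
  have h3 := (h0.mul h1).mul (((hasDerivAt_phi α x hx).const_mul α).sub ((h2.const_mul 2).mul (hasDerivAt_phi (α + 1) x hx)))
  refine HasDerivAt.congr_deriv (f := besselD α) h3 ?_
  have hr := phiB_rec α (Complex.exp (2 * (Real.log (x / 2) : ℂ)))
  simp only [besselD, besselJ_eq, show α + 1 + 1 = α + 2 by ring, Pi.mul_apply, Pi.sub_apply]
  rw [hr]
  simp only [exp_two_log x hx]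
  field_simp
  ring

/-- Derivative of the Hankel function. -/
def hankelD (α : ℂ) (x : ℝ) : ℂ :=
  (besselD (-α) x - Complex.exp (-(Complex.I * (Real.pi : ℂ) * α)) * besselD α x) /
    (Complex.I * Complex.sin (α * (Real.pi : ℂ)))

lemma hankel1_hasDerivAt (α : ℂ) (x : ℝ) (hx : 0 < x) : HasDerivAt (hankel1 α) (hankelD α x) x :=
  ((besselJ_hasDerivAt (-α) x hx).sub ((besselJ_hasDerivAt α x hx).const_mul _)).div_const _

lemma hankelD_hasDerivAt (α : ℂ) (x : ℝ) (hx : 0 < x) : HasDerivAt (hankelD α)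
    (-(1 / (x : ℂ)) * hankelD α x - (1 - α ^ 2 / (x : ℂ) ^ 2) * hankel1 α x) x := by
  refine HasDerivAt.congr_deriv (f := hankelD α)
    (((besselD_hasDerivAt (-α) x hx).sub ((besselD_hasDerivAt α x hx).const_mul
      (Complex.exp (-(Complex.I * (Real.pi : ℂ) * α))))).div_const
      (Complex.I * Complex.sin (α * (Real.pi : ℂ)))) ?_
  unfold hankelD hankel1
  ring

lemma phiB_continuous (α : ℂ) : Continuous (phiB α) :=
  continuous_iff_continuousAt.2 fun z => (phiB_hasDerivAt α z).continuousAt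

lemma besselJ_measurable (α : ℂ) : Measurable (besselJ α) := by
  rw [show besselJ α = fun x => _ from funext (besselJ_eq α)]
  have := (phiB_continuous α).measurable
  fun_prop

lemma besselD_measurable (α : ℂ) : Measurable (besselD α) := by
  unfold besselD
  have := (phiB_continuous α).measurable
  have := (phiB_continuous (α + 1)).measurable
  fun_prop

lemma hankel1_measurable (α : ℂ) : Measurable (hankel1 α) := by
  unfold hankel1
  have := besselJ_measurable α
  have := besselJ_measurable (-α)
  fun_prop

lemma hankelD_measurable (α : ℂ) : Measurable (hankelD α) := by
  unfold hankelD
  have := besselD_measurable α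
  have := besselD_measurable (-α)
  fun_prop

/-- rescaled mode function `w = v / t`. -/
def modeW (m R t k : ℝ) : ℂ :=
  (Real.exp (-(modeMu m R * Real.pi / 2)) : ℂ) * (Real.sqrt t : ℂ) * hankel1 (modeNu m R) (k * t)

def modeWD (m R t k : ℝ) : ℂ :=
  (Real.exp (-(modeMu m R * Real.pi / 2)) : ℂ) *
    ((1 / (2 * Real.sqrt t) : ℝ) * hankel1 (modeNu m R) (k * t) +
      (Real.sqrt t : ℂ) * k * hankelD (modeNu m R) (k * t))

lemma modeW_measurable (m R : ℝ) : Measurable fun p : ℝ × ℝ => modeW m R p.1 p.2 := by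
  unfold modeW
  have := hankel1_measurable (modeNu m R)
  fun_prop

lemma modeWD_measurable (m R : ℝ) : Measurable fun p : ℝ × ℝ => modeWD m R p.1 p.2 := by
  unfold modeWD
  have := hankel1_measurable (modeNu m R)
  have := hankelD_measurable (modeNu m R)
  fun_prop

lemma modeV_eq (m R t k : ℝ) (ht : 0 < t) : modeV m R t k = t * modeW m R t k := by
  unfold modeV modeW
  have : t ^ ((3 : ℝ) / 2) = t * Real.sqrt t := by
    rw [Real.sqrt_eq_rpow, show (3 : ℝ) / 2 = 1 + 1 / 2 by norm_num, Real.rpow_add ht, Real.rpow_one]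
  rw [this]; push_cast; ring

lemma hasDerivAt_scale (g g' : ℝ → ℂ) (k t : ℝ) (h : HasDerivAt g (g' (k * t)) (k * t)) :
    HasDerivAt (fun t => g (k * t)) (k * g' (k * t)) t := by
  have h2 : HasDerivAt (fun t : ℝ => k * t) k t := by simpa using (hasDerivAt_id t).const_mul k
  have := HasDerivAt.scomp t h h2
  exact this.congr_deriv (by simp)

lemma hasDerivAt_csqrt (t : ℝ) (ht : 0 < t) :
    HasDerivAt (fun t : ℝ => (Real.sqrt t : ℂ)) ((1 / (2 * Real.sqrt t) : ℝ) : ℂ) t :=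
  (Real.hasDerivAt_sqrt ht.ne').ofReal_comp

lemma modeW_hasDerivAt (m R t k : ℝ) (ht : 0 < t) (hk : 0 < k) :
    HasDerivAt (fun t => modeW m R t k) (modeWD m R t k) t := by
  have h1 := hasDerivAt_scale _ _ k t (hankel1_hasDerivAt (modeNu m R) (k * t) (by positivity))
  have h2 := (((hasDerivAt_csqrt t ht).mul h1).const_mul
    (Real.exp (-(modeMu m R * Real.pi / 2)) : ℂ))
  refine (h2.congr_of_eventuallyEq ?_).congr_deriv ?_
  · exact Eventually.of_forall fun s => by simp [modeW, mul_assoc]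
  · simp only [modeWD]; ring

lemma modeWD_hasDerivAt (m R t k : ℝ) (ht : 0 < t) (hk : 0 < k) :
    HasDerivAt (fun t => modeWD m R t k)
      (-((k ^ 2 + (modeMu m R ^ 2 + 1 / 4) / t ^ 2 : ℝ) : ℂ) * modeW m R t k) t := by
  have h1 := hasDerivAt_scale _ _ k t (hankel1_hasDerivAt (modeNu m R) (k * t) (by positivity))
  have h1' := hasDerivAt_scale _ 
    (fun x => (-(1 / (x : ℂ)) * hankelD (modeNu m R) x - (1 - (modeNu m R) ^ 2 / (x : ℂ) ^ 2) * hankel1 (modeNu m R) x)) k t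
    (hankelD_hasDerivAt (modeNu m R) (k * t) (by positivity))
  have hs := hasDerivAt_csqrt t ht
  have hs' : HasDerivAt (fun t : ℝ => ((1 / (2 * Real.sqrt t) : ℝ) : ℂ))
      ((-(1 / (4 * t * Real.sqrt t)) : ℝ) : ℂ) t := by
    have h : HasDerivAt (fun t : ℝ => (1 / (2 * Real.sqrt t) : ℝ)) (-(1 / (4 * t * Real.sqrt t))) t := by
      have := (((Real.hasDerivAt_sqrt ht.ne').const_mul 2).inv (by positivity))
      refine (this.congr_deriv ?_).congr_of_eventuallyEq (Eventually.of_forall fun y => by simp)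
      have := Real.sq_sqrt ht.le
      have h3 : 0 < Real.sqrt t := by positivity
      field_simp
      rw [this]; ring
    exact h.ofReal_comp
  have h2 := (((hs'.mul h1).add ((hs.mul_const (k : ℂ)).mul h1')).const_mul
    (Real.exp (-(modeMu m R * Real.pi / 2)) : ℂ))
  refine (h2.congr_of_eventuallyEq ?_).congr_deriv ?_
  · exact Eventually.of_forall fun s => by simp [modeWD]
  · simp only [modeW]
    have hn : modeNu m R ^ 2 = -((modeMu m R : ℂ) ^ 2) := by
      unfold modeNu; rw [mul_pow, Complex.I_sq]; ring
    rw [hn]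
    have h3 : 0 < Real.sqrt t := by positivity
    have h4 : (Real.sqrt t : ℂ) ≠ 0 := by exact_mod_cast h3.ne'
    have h5 : (t : ℂ) = (Real.sqrt t : ℂ) ^ 2 := by
      rw [← Complex.ofReal_pow, Real.sq_sqrt ht.le]
    have h6 : (k : ℂ) ≠ 0 := by exact_mod_cast hk.ne'
    generalize hankel1 _ _ = a
    generalize hankelD _ _ = b
    push_cast
    rw [h5]
    generalize (Real.sqrt t : ℂ) = s at *
    field_simp
    ring

/-- Constancy of the Wronskian. -/
lemma hankel_wronskian (μ : ℝ) : ∃ C : ℝ, ∀ x : ℝ, 0 < x →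
    x * (hankelD (Complex.I * (μ : ℂ)) x * (starRingEnd ℂ) (hankel1 (Complex.I * (μ : ℂ)) x)).im = C := by
  set α := Complex.I * (μ : ℂ) with hα
  have hn : α ^ 2 = ((-(μ ^ 2) : ℝ) : ℂ) := by
    rw [hα, mul_pow, Complex.I_sq]; push_cast; ring
  let F : ℝ → ℂ := fun x => (x : ℂ) * (hankelD α x * (starRingEnd ℂ) (hankel1 α x))
  have hF : ∀ x, 0 < x → HasDerivAt (fun x => (F x).im) 0 x := by
    intro x hx
    have h1 := hankel1_hasDerivAt α x hx
    have h2 := hankelD_hasDerivAt α x hx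
    have h3 : HasDerivAt (fun x => (starRingEnd ℂ) (hankel1 α x)) ((starRingEnd ℂ) (hankelD α x)) x :=
      h1.star
    have h4 : HasDerivAt (fun x : ℝ => (x : ℂ)) 1 x := by simpa using (hasDerivAt_id x).ofReal_comp
    have h5 : HasDerivAt F _ x := h4.mul (h2.mul h3)
    have h6 := (Complex.imCLM.hasFDerivAt (x := F x)).comp_hasDerivAt x h5
    refine HasDerivAt.congr_deriv (f := fun x => (F x).im) h6 ?_
    have hx' : (x : ℂ) ≠ 0 := by exact_mod_cast hx.ne'
    have : (1 * (hankelD α x * (starRingEnd ℂ) (hankel1 α x)) +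
      (x : ℂ) * ((-(1 / (x : ℂ)) * hankelD α x - (1 - α ^ 2 / (x : ℂ) ^ 2) * hankel1 α x) * (starRingEnd ℂ) (hankel1 α x)
        + hankelD α x * (starRingEnd ℂ) (hankelD α x))) 
        = ((x * Complex.normSq (hankelD α x) - (x + μ ^ 2 / x) * Complex.normSq (hankel1 α x) : ℝ) : ℂ) := by
      rw [hn]
      push_cast
      rw [Complex.normSq_eq_conj_mul_self, Complex.normSq_eq_conj_mul_self]
      field_simp
      ring
    rw [this]
    simp only [Complex.imCLM_apply, Complex.ofReal_im]
  refine ⟨(F 1).im, fun x hx => ?_⟩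
  have := (convex_Ioi (0 : ℝ)).is_const_of_fderivWithin_eq_zero (𝕜 := ℝ) (f := fun x => (F x).im)
    (fun y hy => (hF y hy).differentiableAt.differentiableWithinAt)
    (fun y hy => by
      rw [fderivWithin_of_isOpen isOpen_Ioi hy]
      ext; simpa using (hF y hy).deriv) (Set.mem_Ioi.2 hx) (Set.mem_Ioi.2 one_pos)
  rw [← this]
  simp [F]

lemma modeW_wronskian (m R : ℝ) : ∃ C : ℝ, ∀ t k : ℝ, 0 < t → 0 < k →
    (modeWD m R t k * (starRingEnd ℂ) (modeW m R t k)).im = C := by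
  obtain ⟨C, hC⟩ := hankel_wronskian (modeMu m R)
  refine ⟨Real.exp (-(modeMu m R * Real.pi / 2)) ^ 2 * C, fun t k ht hk => ?_⟩
  rw [← hC (k * t) (by positivity)]
  unfold modeWD modeW modeNu
  generalize Real.exp _ = c
  generalize hankel1 _ _ = a
  generalize hankelD _ _ = b
  have h3 : 0 < Real.sqrt t := by positivity
  have h5 : t = (Real.sqrt t) ^ 2 := by rw [Real.sq_sqrt ht.le]
  have : (c : ℂ) * ((1 / (2 * Real.sqrt t) : ℝ) * a + (Real.sqrt t : ℂ) * k * b) *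
      (starRingEnd ℂ) ((c : ℂ) * (Real.sqrt t : ℂ) * a)
      = ((c ^ 2 / 2 * Complex.normSq a : ℝ) : ℂ) + ((c ^ 2 * (k * t) : ℝ) : ℂ) * (b * (starRingEnd ℂ) a) := by
    push_cast
    rw [Complex.normSq_eq_conj_mul_self]
    simp only [map_mul, Complex.conj_ofReal]
    rw [show (t : ℂ) = (Real.sqrt t : ℂ) ^ 2 by rw [← Complex.ofReal_pow, Real.sq_sqrt ht.le]]
    have h4 : (Real.sqrt t : ℂ) ≠ 0 := by exact_mod_cast h3.ne'
    field_simp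
  rw [this, Complex.add_im, Complex.ofReal_im, Complex.im_ofReal_mul]
  ring

/-! ### Abstract finite speed argument -/

lemma fub_aux {Ω : Type*} [MeasurableSpace Ω] (P : Measure Ω) [SFinite P] (φ : Ω → ℂ)
    (hφ : Integrable φ P) (G : Ω → ℝ → ℝ) (hG : Measurable (Function.uncurry G)) (a b C : ℝ)
    (hC : ∀ᵐ ω ∂P, ∀ s ∈ Set.uIoc a b, |G ω s| ≤ C) :
    ∫ ω, ((∫ s in a..b, G ω s : ℝ) : ℂ) * φ ω ∂P = ∫ s in a..b, ∫ ω, (G ω s : ℂ) * φ ω ∂P := by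
  have : IsFiniteMeasure (volume.restrict (Set.uIoc a b)) := ⟨by
    rw [Measure.restrict_apply_univ, Set.uIoc]; exact measure_Ioc_lt_top⟩
  rw [MeasureTheory.intervalIntegral_integral_swap]
  · refine integral_congr_ae (Eventually.of_forall fun ω => ?_)
    simp only
    rw [intervalIntegral.integral_mul_const, intervalIntegral.integral_ofReal]
  · have hint : Integrable (fun z : ℝ × Ω => C * ‖φ z.2‖) ((volume.restrict (Set.uIoc a b)).prod P) :=
      (hφ.norm.const_mul C).comp_snd _
    refine Integrable.mono' hint ?_ ?_
    · have h1 : Measurable fun z : ℝ × Ω => G z.2 z.1 := hG.comp measurable_swap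
      have h2 : AEStronglyMeasurable (fun z : ℝ × Ω => φ z.2) ((volume.restrict (Set.uIoc a b)).prod P) :=
        hφ.1.comp_snd
      exact (Complex.measurable_ofReal.comp h1).aestronglyMeasurable.mul h2
    · have h3 : ∀ᵐ z ∂((volume.restrict (Set.uIoc a b)).prod P), ∀ s ∈ Set.uIoc a b, |G z.2 s| ≤ C :=
        Measure.quasiMeasurePreserving_snd.ae hC
      have h4 : ∀ᵐ z ∂((volume.restrict (Set.uIoc a b)).prod P), z.1 ∈ Set.uIoc a b :=
        Measure.quasiMeasurePreserving_fst.ae (ae_restrict_mem measurableSet_uIoc)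
      filter_upwards [h3, h4] with z h3 h4
      simp only [Function.uncurry, norm_mul, Complex.norm_real, Real.norm_eq_abs]
      exact mul_le_mul_of_nonneg_right (h3 _ h4) (norm_nonneg _)

lemma sin_fub {Ω : Type*} [MeasurableSpace Ω] (P : Measure Ω) [SFinite P] (φ : Ω → ℂ)
    (hφ : Integrable φ P) (K : Ω → ℝ) (hK : Measurable K) (hK0 : ∀ᵐ ω ∂P, 0 < K ω) (σ : ℝ) :
    ∫ ω, ((Real.sin (K ω * σ) / K ω : ℝ) : ℂ) * φ ω ∂P =
      ∫ s in (0:ℝ)..σ, ∫ ω, (Real.cos (K ω * s) : ℂ) * φ ω ∂P := by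
  have := fub_aux P φ hφ (fun ω s => Real.cos (K ω * s)) (by unfold Function.uncurry; fun_prop) 0 σ 1
    (Eventually.of_forall fun ω s _ => Real.abs_cos_le_one _)
  rw [← this]
  refine integral_congr_ae ?_
  filter_upwards [hK0] with ω h
  congr 2
  rw [intervalIntegral.integral_comp_mul_left (fun x => Real.cos x) h.ne']
  simp [div_eq_inv_mul]

lemma ode_bound (k T Q a b : ℝ) (q y y' : ℝ → ℝ) (hQ : ∀ s ∈ Set.Icc 0 T, |q s| ≤ Q) (hQ0 : 0 ≤ Q)
    (h0 : y 0 = a) (h0' : y' 0 = b)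
    (hd : ∀ s ∈ Set.Icc 0 T, HasDerivAt y (y' s) s)
    (hd' : ∀ s ∈ Set.Icc 0 T, HasDerivAt y' (-(k ^ 2 + q s) * y s) s) :
    ∀ s ∈ Set.Icc 0 T, |y s| ≤ Real.sqrt ((a ^ 2 + b ^ 2) * Real.exp ((1 + Q) * T)) := by
  intro s hs
  have hT : 0 ≤ T := hs.1.trans hs.2
  let E : ℝ → ℝ := fun s => Real.exp (-(1 + Q) * s) * (y' s ^ 2 + (k ^ 2 + 1) * y s ^ 2)
  have hE : ∀ s ∈ Set.Icc 0 T, HasDerivAt E (Real.exp (-(1 + Q) * s) * (-(1 + Q) *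
      (y' s ^ 2 + (k ^ 2 + 1) * y s ^ 2) + 2 * y' s * y s * (1 - q s))) s := by
    intro s hs
    have h1 : HasDerivAt (fun s => Real.exp (-(1 + Q) * s)) (Real.exp (-(1 + Q) * s) * (-(1 + Q))) s := by
      simpa using ((hasDerivAt_id s).const_mul (-(1 + Q))).exp
    have h2 := h1.mul (((hd' s hs).pow 2).add (((hd s hs).pow 2).const_mul (k ^ 2 + 1)))
    refine HasDerivAt.congr_deriv (f := E) h2 ?_
    simp only [Pi.add_apply, Pi.pow_apply]
    push_cast
    ring
  have hanti : AntitoneOn E (Set.Icc 0 T) := by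
    apply antitoneOn_of_deriv_nonpos (convex_Icc 0 T)
    · exact fun s hs => (hE s hs).continuousAt.continuousWithinAt
    · exact fun s hs => (hE s (interior_subset hs)).differentiableAt.differentiableWithinAt
    · intro s hs
      have hs := interior_subset hs
      rw [(hE s hs).deriv]
      apply mul_nonpos_of_nonneg_of_nonpos (Real.exp_pos _).le
      have h1 : |1 - q s| ≤ 1 + Q := by
        have := abs_le.1 (hQ s hs)
        rw [abs_le]; constructor <;> linarith
      have h2 : 2 * y' s * y s * (1 - q s) ≤ (y' s ^ 2 + y s ^ 2) * (1 + Q) := by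
        have h3 : 2 * y' s * y s * (1 - q s) ≤ |2 * y' s * y s| * |1 - q s| := by
          rw [← abs_mul]; exact le_abs_self _
        have h4 : |2 * y' s * y s| ≤ y' s ^ 2 + y s ^ 2 := by
          rw [abs_le]; constructor <;> nlinarith [sq_nonneg (y' s + y s), sq_nonneg (y' s - y s)]
        exact h3.trans (mul_le_mul h4 h1 (abs_nonneg _) (by positivity))
      have h5 : 0 ≤ (1 + Q) * (k ^ 2 * y s ^ 2) := by positivity
      nlinarith
  have h := hanti (Set.left_mem_Icc.2 hT) hs hs.1
  simp only [E, h0, h0', mul_zero, Real.exp_zero, one_mul] at h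
  apply Real.abs_le_sqrt
  have e1 : Real.exp ((1 + Q) * s) * Real.exp (-(1 + Q) * s) = 1 := by
    rw [← Real.exp_add, ← Real.exp_zero]; congr 1; ring
  have h6 : y' s ^ 2 + (k ^ 2 + 1) * y s ^ 2 ≤ (b ^ 2 + (k ^ 2 + 1) * a ^ 2) * Real.exp ((1 + Q) * s) := by
    have := mul_le_mul_of_nonneg_left h (Real.exp_pos ((1 + Q) * s)).le
    rw [← mul_assoc, e1, one_mul] at this
    linarith
  have h7 : Real.exp ((1 + Q) * s) ≤ Real.exp ((1 + Q) * T) := by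
    apply Real.exp_le_exp.2
    exact mul_le_mul_of_nonneg_left hs.2 (by positivity)
  have h8 : (k ^ 2 + 1) * y s ^ 2 ≤ (k ^ 2 + 1) * ((a ^ 2 + b ^ 2) * Real.exp ((1 + Q) * T)) := by
    calc (k ^ 2 + 1) * y s ^ 2 ≤ y' s ^ 2 + (k ^ 2 + 1) * y s ^ 2 := by nlinarith [sq_nonneg (y' s)]
      _ ≤ _ := h6
      _ ≤ (b ^ 2 + (k ^ 2 + 1) * a ^ 2) * Real.exp ((1 + Q) * T) := by gcongr
      _ ≤ ((k ^ 2 + 1) * (a ^ 2 + b ^ 2)) * Real.exp ((1 + Q) * T) := by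
        gcongr
        nlinarith [sq_nonneg (k * b)]
      _ = _ := by ring
  exact le_of_mul_le_mul_left h8 (by positivity)

lemma volterra (k T a b : ℝ) (hk : 0 < k) (q y y' : ℝ → ℝ) (hq : ContinuousOn q (Set.Icc 0 T))
    (h0 : y 0 = a) (h0' : y' 0 = b)
    (hd : ∀ s ∈ Set.Icc 0 T, HasDerivAt y (y' s) s)
    (hd' : ∀ s ∈ Set.Icc 0 T, HasDerivAt y' (-(k ^ 2 + q s) * y s) s) :
    ∀ s ∈ Set.Icc 0 T, y s = a * Real.cos (k * s) + b * (Real.sin (k * s) / k)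
      - ∫ r in (0:ℝ)..s, Real.sin (k * (s - r)) / k * q r * y r := by
  intro s hs
  let F : ℝ → ℝ := fun r => Real.cos (k * (s - r)) * y r + Real.sin (k * (s - r)) / k * y' r
  have hsub : Set.uIcc 0 s ⊆ Set.Icc 0 T := by
    rw [Set.uIcc_of_le hs.1]; exact Set.Icc_subset_Icc_right hs.2
  have hF : ∀ r ∈ Set.uIcc 0 s, HasDerivAt F (-(Real.sin (k * (s - r)) / k * q r * y r)) r := by
    intro r hr
    have h1 : HasDerivAt (fun r => k * (s - r)) (-k) r := by
      simpa using ((hasDerivAt_id r).const_sub s).const_mul k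
    have h2 := (h1.cos.mul (hd r (hsub hr))).add ((h1.sin.div_const k).mul (hd' r (hsub hr)))
    refine HasDerivAt.congr_deriv (f := F) h2 ?_
    field_simp
    ring
  have hcy : ContinuousOn y (Set.uIcc 0 s) := fun r hr => (hd r (hsub hr)).continuousAt.continuousWithinAt
  have := intervalIntegral.integral_eq_sub_of_hasDerivAt hF (by
    apply ContinuousOn.intervalIntegrable
    have := hq.mono hsub
    fun_prop)
  rw [intervalIntegral.integral_neg] at this
  simp only [F, sub_self, mul_zero, Real.cos_zero, Real.sin_zero, zero_div, zero_mul, add_zero, one_mul, sub_zero, h0, h0'] at this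
  linarith

lemma bdd_int {Ω : Type*} [MeasurableSpace Ω] {P : Measure Ω} {φ : Ω → ℂ}
    (hφ : Integrable φ P) {g : Ω → ℝ} (hg : Measurable g) (C : ℝ) (hC : ∀ᵐ ω ∂P, |g ω| ≤ C) :
    Integrable (fun ω => (g ω : ℂ) * φ ω) P := by
  refine Integrable.bdd_mul (c := C) hφ (Complex.measurable_ofReal.comp hg).aestronglyMeasurable ?_
  filter_upwards [hC] with ω h
  simpa using h

lemma int_five {Ω : Type*} [MeasurableSpace Ω] {P : Measure Ω} {f₁ f₂ f₃ f₄ f₅ : Ω → ℂ}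
    (h₁ : Integrable f₁ P) (h₂ : Integrable f₂ P) (h₃ : Integrable f₃ P) (h₄ : Integrable f₄ P)
    (h₅ : Integrable f₅ P) : ∫ ω, (f₁ ω + f₂ ω + f₃ ω - f₄ ω - f₅ ω) ∂P =
      ∫ ω, f₁ ω ∂P + ∫ ω, f₂ ω ∂P + ∫ ω, f₃ ω ∂P - ∫ ω, f₄ ω ∂P - ∫ ω, f₅ ω ∂P := by
  have a : Integrable (fun ω => f₁ ω + f₂ ω) P := h₁.add h₂
  have b : Integrable (fun ω => f₁ ω + f₂ ω + f₃ ω) P := a.add h₃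
  have c : Integrable (fun ω => f₁ ω + f₂ ω + f₃ ω - f₄ ω) P := b.sub h₄
  rw [integral_sub c h₅, integral_sub b h₄, integral_add a h₃, integral_add h₁ h₂]

lemma abs_sin_div_le (k s : ℝ) (hk : 0 < k) : |Real.sin (k * s) / k| ≤ |s| := by
  rw [abs_div, abs_of_pos hk, div_le_iff₀ hk]
  have := Real.abs_sin_le_abs (x := k * s)
  rw [abs_mul, abs_of_pos hk] at this
  linarith

theorem speed_core {Ω : Type*} [MeasurableSpace Ω] (P : Measure Ω) [SFinite P] (φ : Ω → ℂ)
    (hφ : Integrable φ P) (K : Ω → ℝ) (hK : Measurable K) (hK0 : ∀ᵐ ω ∂P, 0 < K ω)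
    (T d Q a b : ℝ) (hT : 0 ≤ T) (hTd : T < d) (hQ0 : 0 ≤ Q)
    (hcos : ∀ σ, |σ| < d → ∫ ω, (Real.cos (K ω * σ) : ℂ) * φ ω ∂P = 0)
    (q : ℝ → ℝ) (hqm : Measurable q) (hqc : ContinuousOn q (Set.Icc 0 T))
    (hQ : ∀ s ∈ Set.Icc 0 T, |q s| ≤ Q)
    (Y Y' : Ω → ℝ → ℝ) (hY : Measurable (Function.uncurry Y))
    (h0 : ∀ ω, 0 < K ω → Y ω 0 = a) (h0' : ∀ ω, 0 < K ω → Y' ω 0 = b)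
    (hd : ∀ ω, 0 < K ω → ∀ s ∈ Set.Icc 0 T, HasDerivAt (Y ω) (Y' ω s) s)
    (hd' : ∀ ω, 0 < K ω → ∀ s ∈ Set.Icc 0 T,
      HasDerivAt (Y' ω) (-(K ω ^ 2 + q s) * Y ω s) s) :
    Integrable (fun ω => (Y ω T : ℂ) * φ ω) P ∧ ∫ ω, (Y ω T : ℂ) * φ ω ∂P = 0 := by
  set B := Real.sqrt ((a ^ 2 + b ^ 2) * Real.exp ((1 + Q) * T)) with hB
  have hB0 : 0 ≤ B := Real.sqrt_nonneg _
  have hYB : ∀ s ∈ Set.Icc 0 T, ∀ᵐ ω ∂P, |Y ω s| ≤ B := by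
    intro s hs
    filter_upwards [hK0] with ω h
    exact ode_bound (K ω) T Q a b q (Y ω) (Y' ω) hQ hQ0 (h0 ω h) (h0' ω h) (hd ω h) (hd' ω h) s hs
  have hYs : ∀ s, Measurable fun ω => Y ω s := fun s =>
    hY.comp (measurable_id.prodMk measurable_const)
  have hYφ : ∀ s ∈ Set.Icc 0 T, Integrable (fun ω => (Y ω s : ℂ) * φ ω) P := fun s hs =>
    bdd_int hφ (hYs s) B (hYB s hs)
  refine ⟨hYφ T ⟨hT, le_rfl⟩, ?_⟩
  let U : ℝ → ℝ → ℂ := fun s σ => ∫ ω, (Real.cos (K ω * σ) : ℂ) * ((Y ω s : ℂ) * φ ω) ∂P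
  let N : ℝ → ℝ → ℂ := fun s σ =>
    ∫ ω, ((Real.sin (K ω * σ) / K ω : ℝ) : ℂ) * ((Y ω s : ℂ) * φ ω) ∂P
  have hNU : ∀ s ∈ Set.Icc 0 T, ∀ σ, N s σ = ∫ z in (0:ℝ)..σ, U s z := fun s hs σ =>
    sin_fub P _ (hYφ s hs) K hK hK0 σ
  have hsin : ∀ σ, |σ| < d → ∫ ω, ((Real.sin (K ω * σ) / K ω : ℝ) : ℂ) * φ ω ∂P = 0 := by
    intro σ hσ
    rw [sin_fub P _ hφ K hK hK0 σ]
    rw [intervalIntegral.integral_congr (g := fun _ => 0)]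
    · simp
    · intro z hz
      apply hcos
      refine lt_of_le_of_lt ?_ hσ
      simpa using Set.abs_sub_left_of_mem_uIcc hz
  have hci : ∀ {ψ : Ω → ℂ}, Integrable ψ P → ∀ σ,
      Integrable (fun ω => (Real.cos (K ω * σ) : ℂ) * ψ ω) P := fun hψ σ =>
    bdd_int hψ (by fun_prop) 1 (Eventually.of_forall fun ω => Real.abs_cos_le_one _)
  have hsi : ∀ {ψ : Ω → ℂ}, Integrable ψ P → ∀ σ,
      Integrable (fun ω => ((Real.sin (K ω * σ) / K ω : ℝ) : ℂ) * ψ ω) P := fun hψ σ =>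
    bdd_int hψ (by fun_prop) |σ| (hK0.mono fun ω h => abs_sin_div_le _ _ h)
  have key : ∀ s ∈ Set.Icc 0 T, ∀ σ, |σ| + s < d →
      U s σ = - ∫ r in (0:ℝ)..s, (q r / 2 : ℂ) * (N r (σ + (s - r)) - N r (σ - (s - r))) := by
    intro s hs σ hσ
    let G : Ω → ℝ → ℝ := fun ω r =>
      Real.cos (K ω * σ) * (Real.sin (K ω * (s - r)) / K ω * q r * Y ω r)
    have hGm : Measurable (Function.uncurry G) := by
      have : Function.uncurry G = fun p : Ω × ℝ => Real.cos (K p.1 * σ) *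
        (Real.sin (K p.1 * (s - p.2)) / K p.1 * q p.2 * Function.uncurry Y p) := rfl
      rw [this]
      fun_prop
    have hGb : ∀ᵐ ω ∂P, ∀ r ∈ Set.uIoc 0 s, |G ω r| ≤ T * Q * B := by
      filter_upwards [hK0] with ω h r hr
      rw [Set.uIoc_of_le hs.1] at hr
      have hr' : r ∈ Set.Icc 0 T := ⟨hr.1.le, hr.2.trans hs.2⟩
      have e1 := abs_sin_div_le (K ω) (s - r) h
      have e2 : |s - r| ≤ T := by
        rw [abs_of_nonneg (by linarith [hr.2])]; linarith [hr.1, hs.2]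
      have e3 := ode_bound (K ω) T Q a b q (Y ω) (Y' ω) hQ hQ0 (h0 ω h) (h0' ω h) (hd ω h)
        (hd' ω h) r hr'
      simp only [G, abs_mul]
      calc _ ≤ 1 * (T * Q * B) := by
            gcongr
            · exact Real.abs_cos_le_one _
            · exact e1.trans e2
            · exact hQ r hr'
        _ = _ := one_mul _
    have hfub := fub_aux P φ hφ G hGm 0 s (T * Q * B) hGb
    have hN2 : ∀ r ∈ Set.uIcc 0 s, ∫ ω, (G ω r : ℂ) * φ ω ∂P =
        (q r / 2 : ℂ) * (N r (σ + (s - r)) - N r (σ - (s - r))) := by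
      intro r hr
      rw [Set.uIcc_of_le hs.1] at hr
      have hr' : r ∈ Set.Icc 0 T := ⟨hr.1, hr.2.trans hs.2⟩
      simp only [N]
      rw [← integral_sub (hsi (hYφ r hr') _) (hsi (hYφ r hr') _), ← integral_const_mul]
      refine integral_congr_ae (Eventually.of_forall fun ω => ?_)
      simp only [G]
      have : Real.cos (K ω * σ) * Real.sin (K ω * (s - r)) =
          (Real.sin (K ω * (σ + (s - r))) - Real.sin (K ω * (σ - (s - r)))) / 2 := by
        rw [mul_add, mul_sub _ σ, Real.sin_add, Real.sin_sub]; ring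
      have e : Real.cos (K ω * σ) * (Real.sin (K ω * (s - r)) / K ω * q r * Y ω r) =
          q r / 2 * (Real.sin (K ω * (σ + (s - r))) / K ω - Real.sin (K ω * (σ - (s - r))) / K ω)
          * Y ω r := by
        linear_combination (q r * Y ω r / K ω) * this
      rw [e]
      push_cast
      ring
    rw [intervalIntegral.integral_congr hN2] at hfub
    rw [← hfub]
    have hIG : Integrable (fun ω => ((∫ r in (0:ℝ)..s, G ω r : ℝ) : ℂ) * φ ω) P := by
      refine bdd_int hφ ?_ (T * Q * B * |s - 0|) ?_
      · simp only [intervalIntegral]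
        exact (hGm.stronglyMeasurable.integral_prod_right.sub
          hGm.stronglyMeasurable.integral_prod_right).measurable
      · filter_upwards [hGb] with ω h
        exact intervalIntegral.norm_integral_le_of_norm_le_const (f := G ω) (C := T * Q * B)
          fun x hx => h x hx
    have hsum : ∫ ω, ((a / 2 : ℂ) * ((Real.cos (K ω * (σ + s)) : ℂ) * φ ω)
        + (a / 2 : ℂ) * ((Real.cos (K ω * (σ - s)) : ℂ) * φ ω)
        + (b / 2 : ℂ) * (((Real.sin (K ω * (σ + s)) / K ω : ℝ) : ℂ) * φ ω)
        - (b / 2 : ℂ) * (((Real.sin (K ω * (σ - s)) / K ω : ℝ) : ℂ) * φ ω)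
        - ((∫ r in (0:ℝ)..s, G ω r : ℝ) : ℂ) * φ ω) ∂P =
        - ∫ ω, ((∫ r in (0:ℝ)..s, G ω r : ℝ) : ℂ) * φ ω ∂P := by
      have i1 := (hci hφ (σ + s)).const_mul (a / 2 : ℂ)
      have i2 := (hci hφ (σ - s)).const_mul (a / 2 : ℂ)
      have i3 := (hsi hφ (σ + s)).const_mul (b / 2 : ℂ)
      have i4 := (hsi hφ (σ - s)).const_mul (b / 2 : ℂ)
      have p1 : |σ + s| < d := lt_of_le_of_lt ((abs_add_le _ _).trans (by rw [abs_of_nonneg hs.1])) hσ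
      have p2 : |σ - s| < d := lt_of_le_of_lt ((abs_sub _ _).trans (by rw [abs_of_nonneg hs.1])) hσ
      rw [int_five i1 i2 i3 i4 hIG]
      simp only [integral_const_mul, hcos _ p1, hcos _ p2, hsin _ p1, hsin _ p2]
      simp
    rw [← hsum]
    refine integral_congr_ae ?_
    filter_upwards [hK0] with ω h
    have hv := volterra (K ω) T a b h q (Y ω) (Y' ω) hqc (h0 ω h) (h0' ω h) (hd ω h) (hd' ω h) s hs
    have hGi : ∫ r in (0:ℝ)..s, G ω r = Real.cos (K ω * σ) *
      ∫ r in (0:ℝ)..s, Real.sin (K ω * (s - r)) / K ω * q r * Y ω r :=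
      intervalIntegral.integral_const_mul _ _
    have e : Real.cos (K ω * σ) * Y ω s = a / 2 * Real.cos (K ω * (σ + s))
        + a / 2 * Real.cos (K ω * (σ - s)) + b / 2 * (Real.sin (K ω * (σ + s)) / K ω)
        - b / 2 * (Real.sin (K ω * (σ - s)) / K ω) - ∫ r in (0:ℝ)..s, G ω r := by
      rw [hGi, hv, mul_add, mul_sub _ σ, Real.sin_add, Real.sin_sub, Real.cos_add, Real.cos_sub]
      ring
    have e' := congrArg (fun x : ℝ => (x : ℂ)) e
    simp only [ofReal_mul, ofReal_sub, ofReal_add] at e'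
    simp only [← mul_assoc]
    rw [e']
    push_cast
    ring
  set B₁ := B * ∫ ω, ‖φ ω‖ ∂P with hB₁
  have hB₁0 : 0 ≤ B₁ := mul_nonneg hB0 (integral_nonneg fun _ => norm_nonneg _)
  have hd0 : 0 < d := lt_of_le_of_lt hT hTd
  have bound : ∀ n : ℕ, ∀ s ∈ Set.Icc 0 T, ∀ σ, |σ| + s < d →
      ‖U s σ‖ ≤ B₁ * (Q * d * s) ^ n / n.factorial := by
    intro n
    induction n with
    | zero =>
      intro s hs σ _
      simp only [U, pow_zero, Nat.factorial_zero, Nat.cast_one, mul_one, div_one]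
      rw [hB₁, ← integral_const_mul]
      refine norm_integral_le_of_norm_le (hφ.norm.const_mul B) ?_
      filter_upwards [hYB s hs] with ω h
      rw [norm_mul, norm_mul, Complex.norm_real, Complex.norm_real]
      calc _ ≤ 1 * (B * ‖φ ω‖) := by
            gcongr
            · exact Real.abs_cos_le_one _
            · exact h
        _ = _ := one_mul _
    | succ n ih =>
      intro s hs σ hσ
      have hNb : ∀ r ∈ Set.Icc 0 s, ∀ τ, |τ| + r < d →
          ‖N r τ‖ ≤ d * (B₁ * (Q * d * r) ^ n / n.factorial) := by
        intro r hr τ hτ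
        have hr' : r ∈ Set.Icc 0 T := ⟨hr.1, hr.2.trans hs.2⟩
        rw [hNU r hr']
        have hpos : 0 ≤ B₁ * (Q * d * r) ^ n / n.factorial := by
          have := hr.1
          positivity
        refine (intervalIntegral.norm_integral_le_of_norm_le_const
          (C := B₁ * (Q * d * r) ^ n / n.factorial) fun z hz => ih r hr' z ?_).trans ?_
        · have := Set.abs_sub_left_of_mem_uIcc (Set.uIoc_subset_uIcc hz)
          simp only [sub_zero] at this
          linarith
        · rw [sub_zero, mul_comm]
          have : |τ| ≤ d := by linarith [hr.1]
          gcongr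
      rw [key s hs σ hσ, norm_neg]
      have hint : ∫ r in (0:ℝ)..s, Q * (d * (B₁ * (Q * d * r) ^ n / n.factorial)) =
          B₁ * (Q * d * s) ^ (n + 1) / (n + 1).factorial := by
        have : ∀ r : ℝ, Q * (d * (B₁ * (Q * d * r) ^ n / n.factorial)) =
          (Q * d * B₁ * (Q * d) ^ n / n.factorial) * r ^ n := by
          intro r; rw [mul_pow]; ring
        simp only [this]
        rw [intervalIntegral.integral_const_mul, integral_pow, Nat.factorial_succ]
        push_cast
        have : (n.factorial : ℝ) ≠ 0 := by positivity
        have : (n + 1 : ℝ) ≠ 0 := by positivity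
        simp only [zero_pow (Nat.succ_ne_zero n), sub_zero]
        field_simp
        ring
      rw [← hint]
      refine intervalIntegral.norm_integral_le_of_norm_le hs.1 ?_ ?_
      · refine Eventually.of_forall fun r hr => ?_
        have hr1 : r ∈ Set.Icc 0 s := ⟨hr.1.le, hr.2⟩
        have hr' : r ∈ Set.Icc 0 T := ⟨hr.1.le, hr.2.trans hs.2⟩
        have hsr : |s - r| = s - r := abs_of_nonneg (by linarith [hr.2])
        have n1 := hNb r hr1 (σ + (s - r)) (by
          have := abs_add_le σ (s - r); rw [hsr] at this; linarith)
        have n2 := hNb r hr1 (σ - (s - r)) (by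
          have := abs_sub σ (s - r); rw [hsr] at this; linarith)
        rw [norm_mul]
        have n3 := norm_sub_le (N r (σ + (s - r))) (N r (σ - (s - r)))
        have n4 : ‖(q r / 2 : ℂ)‖ ≤ Q / 2 := by
          rw [norm_div, Complex.norm_real]
          have := hQ r hr'
          rw [← Real.norm_eq_abs] at this
          simp only [Complex.norm_ofNat]
          linarith
        calc _ ≤ Q / 2 * (d * (B₁ * (Q * d * r) ^ n / n.factorial)
              + d * (B₁ * (Q * d * r) ^ n / n.factorial)) := by
              refine mul_le_mul n4 (by linarith) (norm_nonneg _) (by positivity)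
          _ = _ := by ring
      · apply Continuous.intervalIntegrable
        fun_prop
  have hlim : Tendsto (fun n : ℕ => B₁ * (Q * d * T) ^ n / n.factorial) atTop (nhds 0) := by
    have := (FloorSemiring.tendsto_pow_div_factorial_atTop (Q * d * T)).const_mul B₁
    simpa [mul_div_assoc] using this
  have hU0 : ‖U T 0‖ ≤ 0 := ge_of_tendsto' hlim fun n => bound n T ⟨hT, le_rfl⟩ 0 (by simpa using hTd)
  have := norm_le_zero_iff.1 hU0
  simpa [U] using this

/-! ### The cosine propagator -/

lemma disc_vol (ρ : ℝ) : volume.real {w : Fin 2 → ℝ | w 0 ^ 2 + w 1 ^ 2 < ρ} =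
    Real.pi * max 0 ρ := by
  rcases le_or_gt ρ 0 with h | h
  · have : {w : Fin 2 → ℝ | w 0 ^ 2 + w 1 ^ 2 < ρ} = ∅ := by
      ext w
      simp only [Set.mem_ofPred_eq, Set.mem_empty_iff_false, iff_false, not_lt]
      nlinarith [sq_nonneg (w 0), sq_nonneg (w 1)]
    rw [this, max_eq_left h]
    simp
  · have hpre : {w : Fin 2 → ℝ | w 0 ^ 2 + w 1 ^ 2 < ρ} =
        (WithLp.toLp 2) ⁻¹' (Metric.ball (0 : EuclideanSpace ℝ (Fin 2)) (Real.sqrt ρ)) := by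
      ext w
      simp only [Set.mem_ofPred_eq, Set.mem_preimage, mem_ball_zero_iff]
      rw [EuclideanSpace.norm_eq, Real.sqrt_lt_sqrt_iff (by positivity)]
      simp [Fin.sum_univ_two]
    have hv : volume {w : Fin 2 → ℝ | w 0 ^ 2 + w 1 ^ 2 < ρ} =
        volume (Metric.ball (0 : EuclideanSpace ℝ (Fin 2)) (Real.sqrt ρ)) := by
      rw [hpre]
      exact (PiLp.volume_preserving_toLp (Fin 2)).measure_preimage
        Metric.isOpen_ball.measurableSet.nullMeasurableSet
    rw [Measure.real, hv, EuclideanSpace.volume_ball_fin_two, ENNReal.toReal_mul, ENNReal.toReal_pow,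
      ENNReal.toReal_ofReal (Real.sqrt_nonneg _), ENNReal.toReal_ofReal Real.pi_pos.le,
      Real.sq_sqrt h.le, max_eq_right h.le, mul_comm]

lemma ball_cos_axis (r σ : ℝ) (hσ : 0 < σ) :
    ∫ x in Metric.ball (0 : V3) σ, Real.cos (r * x 0) =
      Real.pi * ∫ z in (-σ)..σ, Real.cos (r * z) * (σ ^ 2 - z ^ 2) := by
  let H : ℝ × (Fin 2 → ℝ) → ℝ := fun p =>
    Set.indicator {p : ℝ × (Fin 2 → ℝ) | p.1 ^ 2 + (p.2 0 ^ 2 + p.2 1 ^ 2) < σ ^ 2}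
      (fun p => Real.cos (r * p.1)) p
  let e : V3 → ℝ × (Fin 2 → ℝ) := fun x =>
    MeasurableEquiv.piFinSuccAbove (fun _ : Fin 3 => ℝ) 0 (WithLp.ofLp x)
  have he : MeasurePreserving e volume volume :=
    (volume_preserving_piFinSuccAbove (fun _ : Fin 3 => ℝ) 0).comp (PiLp.volume_preserving_ofLp (Fin 3))
  have hemb : MeasurableEmbedding e :=
    (MeasurableEquiv.piFinSuccAbove (fun _ : Fin 3 => ℝ) 0).measurableEmbedding.comp
      (MeasurableEquiv.toLp 2 (Fin 3 → ℝ)).symm.measurableEmbedding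
  have hHe : ∀ x, H (e x) = Set.indicator (Metric.ball (0 : V3) σ) (fun x => Real.cos (r * x 0)) x := by
    intro x
    have h1 : (e x).1 = x 0 := rfl
    have h2 : (e x).2 0 = x 1 := rfl
    have h3 : (e x).2 1 = x 2 := rfl
    simp only [H, Set.indicator, Set.mem_ofPred_eq, mem_ball_zero_iff, h1, h2, h3]
    have : (x 0 ^ 2 + (x 1 ^ 2 + x 2 ^ 2) < σ ^ 2) ↔ ‖x‖ < σ := by
      rw [EuclideanSpace.norm_eq, Real.sqrt_lt' hσ]
      simp [Fin.sum_univ_three, add_assoc]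
    simp only [this]
  have hint : Integrable H volume := by
    rw [← he.integrable_comp_emb hemb]
    have : H ∘ e = Set.indicator (Metric.ball (0 : V3) σ) (fun x => Real.cos (r * x 0)) := funext hHe
    rw [this, integrable_indicator_iff measurableSet_ball]
    have hc : Continuous (fun x : V3 => Real.cos (r * x 0)) := by fun_prop
    exact (hc.continuousOn.integrableOn_compact (isCompact_closedBall (0 : V3) σ)).mono_set
      Metric.ball_subset_closedBall
  rw [← integral_indicator measurableSet_ball]
  simp only [← hHe]
  rw [he.integral_comp hemb]
  rw [Measure.volume_eq_prod, integral_prod _ (by rwa [← Measure.volume_eq_prod])]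
  have hin : ∀ z : ℝ, ∫ w : Fin 2 → ℝ, H (z, w) = Real.pi * (Real.cos (r * z) * max 0 (σ ^ 2 - z ^ 2)) := by
    intro z
    have : ∀ w, H (z, w) = Set.indicator {w : Fin 2 → ℝ | w 0 ^ 2 + w 1 ^ 2 < σ ^ 2 - z ^ 2}
        (fun _ => Real.cos (r * z)) w := by
      intro w
      simp only [H, Set.indicator, Set.mem_ofPred_eq]
      congr 1
      rw [lt_sub_iff_add_lt', eq_iff_iff]
    simp only [this]
    rw [integral_indicator_const, disc_vol]
    · simp only [smul_eq_mul]; ring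
    · apply measurableSet_lt <;> fun_prop
  simp only [hin]
  rw [integral_const_mul, intervalIntegral.integral_of_le (by linarith)]
  congr 1
  rw [← setIntegral_eq_integral_of_forall_compl_eq_zero (s := Set.Ioc (-σ) σ)]
  · refine setIntegral_congr_fun measurableSet_Ioc fun z hz => ?_
    rw [max_eq_right]
    nlinarith [hz.1, hz.2]
  · intro z hz
    rw [max_eq_left, mul_zero]
    by_contra hc
    push Not at hc
    have : |z| < σ := by
      rw [← abs_of_pos hσ]; exact sq_lt_sq.1 (by linarith)
    rw [abs_lt] at this
    exact hz ⟨this.1, this.2.le⟩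

lemma ball_cos (k : V3) (σ : ℝ) (hσ : 0 < σ) :
    ∫ x in Metric.ball (0 : V3) σ, Real.cos ⟪k, x⟫ =
      Real.pi * ∫ z in (-σ)..σ, Real.cos (‖k‖ * z) * (σ ^ 2 - z ^ 2) := by
  rw [← ball_cos_axis _ _ hσ]
  let w : V3 := ‖k‖ • EuclideanSpace.single (0 : Fin 3) (1 : ℝ)
  have hw : ‖k‖ = ‖w‖ := by simp [w, norm_smul]
  let A : V3 ≃ₗᵢ[ℝ] V3 := (Submodule.span ℝ {k - w})ᗮ.reflection
  have hA : A k = w := Submodule.reflection_sub hw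
  have hin : ∀ x : V3, ⟪k, x⟫ = ‖k‖ * (A x) 0 := by
    intro x
    rw [← A.inner_map_map k x, hA]
    simp only [w, inner_smul_left, EuclideanSpace.inner_single_left]
    simp
  rw [← integral_indicator measurableSet_ball, ← integral_indicator measurableSet_ball]
  rw [← A.measurePreserving.integral_comp A.toHomeomorph.measurableEmbedding
    (Set.indicator (Metric.ball (0 : V3) σ) fun x => Real.cos (‖k‖ * x 0))]
  congr 1
  ext x
  simp [Set.indicator, hin]

lemma even_zero (g : ℝ → ℂ) (hg : Continuous g) (hev : ∀ z, g (-z) = g z) (d : ℝ)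
    (h : ∀ σ, 0 < σ → σ < d → ∫ z in (-σ)..σ, (σ ^ 2 - z ^ 2 : ℂ) * g z = 0) :
    ∀ σ, |σ| < d → g σ = 0 := by
  have hder : ∀ p : ℝ → ℂ, Continuous p → (∀ z, p (-z) = p z) → ∀ σ,
      HasDerivAt (fun σ => ∫ z in (-σ)..σ, p z) (2 * p σ) σ := by
    intro p hp hpe σ
    have hP : ∀ x, HasDerivAt (fun x => ∫ z in (0:ℝ)..x, p z) (p x) x := fun x =>
      intervalIntegral.integral_hasDerivAt_right (hp.intervalIntegrable _ _)
        (hp.stronglyMeasurableAtFilter _ _) hp.continuousAt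
    have h1 := (hP σ).sub ((hP (-σ)).scomp σ (hasDerivAt_neg σ))
    refine (h1.congr_deriv ?_).congr_of_eventuallyEq (Eventually.of_forall fun x => ?_)
    · rw [hpe]; simp; ring
    · simp only [Pi.sub_apply, Function.comp]
      rw [intervalIntegral.integral_interval_sub_left] <;> exact hp.intervalIntegrable _ _
  have hA := hder g hg hev
  have hB := hder (fun z => (z : ℂ) ^ 2 * g z) (by fun_prop) (by intro z; simp [hev])
  have hsplit : ∀ σ : ℝ, ∫ z in (-σ)..σ, (σ ^ 2 - z ^ 2 : ℂ) * g z =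
      (σ : ℂ) ^ 2 * (∫ z in (-σ)..σ, g z) - ∫ z in (-σ)..σ, (z : ℂ) ^ 2 * g z := by
    intro σ
    rw [← intervalIntegral.integral_const_mul, ← intervalIntegral.integral_sub]
    · simp only [sub_mul]
    · apply Continuous.intervalIntegrable; fun_prop
    · apply Continuous.intervalIntegrable; fun_prop
  have hA0 : ∀ σ, 0 < σ → σ < d → ∫ z in (-σ)..σ, g z = 0 := by
    intro σ h0 h1
    have hsq : HasDerivAt (fun σ : ℝ => (σ : ℂ) ^ 2) (2 * σ) σ := by
      have h2 := (Complex.ofRealCLM.hasDerivAt (x := σ)).pow 2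
      exact HasDerivAt.congr_deriv (f := fun σ : ℝ => (σ : ℂ) ^ 2) h2 (by simp)
    have hD := (hsq.mul (hA σ)).sub (hB σ)
    have hev0 : (fun σ : ℝ => (σ : ℂ) ^ 2 * (∫ z in (-σ)..σ, g z) - ∫ z in (-σ)..σ, (z : ℂ) ^ 2 * g z)
        =ᶠ[nhds σ] fun _ => 0 := by
      filter_upwards [Ioo_mem_nhds h0 h1] with τ hτ
      rw [← hsplit, h τ hτ.1 hτ.2]
    have hz := hD.unique ((hasDerivAt_const σ (0:ℂ)).congr_of_eventuallyEq hev0)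
    have hz' : (2 * σ : ℂ) * (∫ z in (-σ)..σ, g z) = 0 := by linear_combination hz
    have : (2 * σ : ℂ) ≠ 0 := by
      have : (σ : ℂ) ≠ 0 := by exact_mod_cast h0.ne'
      simpa using this
    exact (mul_eq_zero.1 hz').resolve_left this
  have hg0 : ∀ σ, 0 < σ → σ < d → g σ = 0 := by
    intro σ h0 h1
    have hev0 : (fun σ : ℝ => ∫ z in (-σ)..σ, g z) =ᶠ[nhds σ] fun _ => 0 := by
      filter_upwards [Ioo_mem_nhds h0 h1] with τ hτ
      exact hA0 τ hτ.1 hτ.2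
    have hz := (hA σ).unique ((hasDerivAt_const σ (0:ℂ)).congr_of_eventuallyEq hev0)
    simpa using hz
  intro σ hσ
  rcases lt_trichotomy σ 0 with h1 | h1 | h1
  · rw [← hev]; exact hg0 _ (by linarith) (by rwa [abs_of_neg h1] at hσ)
  · subst h1
    have hd : 0 < d := by simpa using hσ
    have t1 : Tendsto g (nhdsWithin 0 (Set.Ioi 0)) (nhds (g 0)) :=
      hg.continuousAt.tendsto.mono_left nhdsWithin_le_nhds
    have t2 : Tendsto g (nhdsWithin 0 (Set.Ioi 0)) (nhds 0) := by
      refine tendsto_const_nhds.congr' ?_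
      filter_upwards [Ioo_mem_nhdsGT hd] with τ hτ
      exact (hg0 τ hτ.1 hτ.2).symm
    exact tendsto_nhds_unique t1 t2
  · exact hg0 σ h1 (by rwa [abs_of_pos h1] at hσ)

lemma ft_eq_fourier (g : V3 → ℂ) (k : V3) :
    ft g k = (((2 * Real.pi) ^ (-(3 : ℝ) / 2) : ℝ) : ℂ) *
      FourierTransform.fourier g ((2 * Real.pi)⁻¹ • k) := by
  rw [ft, Real.fourier_eq]
  congr 2
  ext x
  rw [inner_smul_right, Circle.smul_def, Real.fourierChar_apply, smul_eq_mul]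
  congr 2
  rw [real_inner_comm]
  have : (Real.pi : ℂ) ≠ 0 := by exact_mod_cast Real.pi_ne_zero
  push_cast
  field_simp

lemma fourier_nice (f : V3 → ℝ) (hf : ContDiff ℝ (⊤ : ℕ∞) f) (hfc : HasCompactSupport f) :
    Integrable (FourierTransform.fourier fun x => (f x : ℂ)) ∧
      FourierTransformInv.fourierInv (FourierTransform.fourier fun x => (f x : ℂ)) = fun x => (f x : ℂ) := by
  have hg : ContDiff ℝ (⊤ : ℕ∞) (fun x => (f x : ℂ)) := Complex.ofRealCLM.contDiff.comp hf
  have hgc : HasCompactSupport (fun x => (f x : ℂ)) := hfc.comp_left (g := fun r : ℝ => (r : ℂ)) (by simp)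
  let S : SchwartzMap V3 ℂ := hgc.toSchwartzMap hg
  have hS : (S : V3 → ℂ) = fun x => (f x : ℂ) := rfl
  have h1 : Integrable (FourierTransform.fourier fun x => (f x : ℂ)) := by
    have := (FourierTransform.fourier S).integrable (μ := volume)
    rwa [SchwartzMap.fourier_coe, hS] at this
  refine ⟨h1, ?_⟩
  exact hg.continuous.fourierInv_fourier_eq (hg.continuous.integrable_of_hasCompactSupport hgc) h1

lemma ft_integrable (f : V3 → ℝ) (hf : ContDiff ℝ (⊤ : ℕ∞) f) (hfc : HasCompactSupport f) :
    Integrable (ft fun x => (f x : ℂ)) := by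
  have : (ft fun x => (f x : ℂ)) = fun k => (((2 * Real.pi) ^ (-(3 : ℝ) / 2) : ℝ) : ℂ) *
      FourierTransform.fourier (fun x => (f x : ℂ)) ((2 * Real.pi)⁻¹ • k) :=
    funext fun k => ft_eq_fourier _ k
  rw [this]
  exact ((fourier_nice f hf hfc).1.comp_smul (by positivity)).const_mul _

lemma ft_inv (f : V3 → ℝ) (hf : ContDiff ℝ (⊤ : ℕ∞) f) (hfc : HasCompactSupport f) :
    ∃ c : ℂ, ∀ x, ∫ k : V3, Complex.exp (Complex.I * (⟪k, x⟫ : ℂ)) * ft (fun x => (f x : ℂ)) k =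
      c * f x := by
  refine ⟨|(((2 * Real.pi)⁻¹) ^ Module.finrank ℝ V3)⁻¹| * (((2 * Real.pi) ^ (-(3 : ℝ) / 2) : ℝ) : ℂ),
    fun x => ?_⟩
  have h2 := congrFun (fourier_nice f hf hfc).2 x
  rw [Real.fourierInv_eq] at h2
  have h3 := Measure.integral_comp_smul (volume : Measure V3) (fun v => Real.fourierChar ⟪v, x⟫ •
    FourierTransform.fourier (fun x => (f x : ℂ)) v) (2 * Real.pi)⁻¹
  rw [h2] at h3
  rw [Complex.real_smul] at h3
  have : ∀ k : V3, Complex.exp (Complex.I * (⟪k, x⟫ : ℂ)) * ft (fun x => (f x : ℂ)) k =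
      (((2 * Real.pi) ^ (-(3 : ℝ) / 2) : ℝ) : ℂ) * (Real.fourierChar ⟪(2 * Real.pi)⁻¹ • k, x⟫ •
        FourierTransform.fourier (fun x => (f x : ℂ)) ((2 * Real.pi)⁻¹ • k)) := by
    intro k
    rw [ft_eq_fourier, inner_smul_left, Circle.smul_def, Real.fourierChar_apply, smul_eq_mul]
    rw [← mul_assoc, ← mul_assoc, mul_comm (Complex.exp _)]
    congr 3
    have : (Real.pi : ℂ) ≠ 0 := by exact_mod_cast Real.pi_ne_zero
    simp only [conj_trivial]
    push_cast
    field_simp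
  simp only [this]
  rw [integral_const_mul, h3]
  ring

lemma ft_conj (f : V3 → ℝ) (k : V3) :
    (starRingEnd ℂ) (ft (fun x => (f x : ℂ)) (-k)) = ft (fun x => (f x : ℂ)) k := by
  simp only [ft, map_mul, Complex.conj_ofReal, ← integral_conj, ← Complex.exp_conj,
    Complex.conj_I, inner_neg_left, Complex.ofReal_neg, mul_neg, neg_mul, neg_neg]

lemma cos_prop (f : V3 → ℝ) (hf : ContDiff ℝ (⊤ : ℕ∞) f) (hfc : HasCompactSupport f) (y : V3) (d : ℝ)
    (hd : ∀ x, dist x y < d → f x = 0) (φ : V3 → ℂ)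
    (hφ : φ = fun k => Complex.exp (Complex.I * (⟪k, y⟫ : ℂ)) * ft (fun x => (f x : ℂ)) k) :
    Integrable φ ∧ ∀ σ, |σ| < d → ∫ k, (Real.cos (‖k‖ * σ) : ℂ) * φ k = 0 := by
  have hexp : ∀ r : ℝ, ‖Complex.exp (Complex.I * (r : ℂ))‖ = 1 := fun r => by
    rw [mul_comm]; exact Complex.norm_exp_ofReal_mul_I r
  have hφi : Integrable φ := by
    rw [hφ]
    refine (ft_integrable f hf hfc).bdd_mul (c := 1) (by fun_prop) (Eventually.of_forall fun k => ?_)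
    exact (hexp _).le
  refine ⟨hφi, ?_⟩
  obtain ⟨c, hc⟩ := ft_inv f hf hfc
  apply even_zero
  · refine continuous_of_dominated (bound := fun k => ‖φ k‖) ?_ ?_ hφi.norm ?_
    · intro σ
      exact (bdd_int hφi (g := fun k => Real.cos (‖k‖ * σ)) (by fun_prop) 1
        (Eventually.of_forall fun k => Real.abs_cos_le_one _)).1
    · intro σ
      refine Eventually.of_forall fun k => ?_
      rw [norm_mul, Complex.norm_real]
      exact mul_le_of_le_one_left (norm_nonneg _) (Real.abs_cos_le_one _)
    · refine Eventually.of_forall fun k => ?_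
      fun_prop
  · intro z; simp
  · intro σ h0 h1
    have hfub := fub_aux volume φ hφi (fun k z => Real.cos (‖k‖ * z) * (σ ^ 2 - z ^ 2))
      (by unfold Function.uncurry; fun_prop) (-σ) σ (σ ^ 2) (by
        refine Eventually.of_forall fun k z hz => ?_
        rw [Set.uIoc_of_le (by linarith)] at hz
        rw [abs_mul]
        have e1 : |σ ^ 2 - z ^ 2| ≤ σ ^ 2 := by
          rw [abs_le]; constructor <;> nlinarith [hz.1, hz.2, sq_nonneg z]
        exact (mul_le_of_le_one_left (abs_nonneg _) (Real.abs_cos_le_one _)).trans e1)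
    have hr : ∀ z : ℝ, ∫ k, ((Real.cos (‖k‖ * z) * (σ ^ 2 - z ^ 2) : ℝ) : ℂ) * φ k =
        (σ ^ 2 - z ^ 2 : ℂ) * ∫ k, (Real.cos (‖k‖ * z) : ℂ) * φ k := by
      intro z
      rw [← integral_const_mul]
      congr 1
      ext k
      push_cast
      ring
    simp only [hr] at hfub
    rw [← hfub]
    have hball : ∀ k : V3, ((∫ z in (-σ)..σ, Real.cos (‖k‖ * z) * (σ ^ 2 - z ^ 2) : ℝ) : ℂ) * φ k =
        (Real.pi : ℂ)⁻¹ * ∫ x in Metric.ball (0 : V3) σ, (Real.cos ⟪k, x⟫ : ℂ) * φ k := by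
      intro k
      rw [integral_mul_const, integral_complex_ofReal, ball_cos k σ h0]
      have : (Real.pi : ℂ) ≠ 0 := by exact_mod_cast Real.pi_ne_zero
      push_cast
      field_simp
    simp only [hball]
    rw [integral_const_mul]
    have hfin : IsFiniteMeasure (volume.restrict (Metric.ball (0 : V3) σ)) :=
      ⟨by rw [Measure.restrict_apply_univ]; exact measure_ball_lt_top⟩
    rw [integral_integral_swap]
    · rw [setIntegral_congr_fun (g := fun _ => 0) measurableSet_ball]
      · simp
      intro x hx
      have hx' : ‖x‖ < d := (mem_ball_zero_iff.1 hx).trans h1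
      have z1 := hc (y + x)
      have z2 := hc (y - x)
      rw [hd _ (by simpa [dist_eq_norm] using hx')] at z1 z2
      have hi : ∀ w : V3, Integrable fun k => Complex.exp (Complex.I * (⟪k, w⟫ : ℂ)) *
          ft (fun x => (f x : ℂ)) k := fun w =>
        (ft_integrable f hf hfc).bdd_mul (c := 1) (by fun_prop)
          (Eventually.of_forall fun k => (hexp _).le)
      have e : ∀ k, (Real.cos ⟪k, x⟫ : ℂ) * φ k = (1 / 2 : ℂ) *
          (Complex.exp (Complex.I * (⟪k, y + x⟫ : ℂ)) * ft (fun x => (f x : ℂ)) k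
          + Complex.exp (Complex.I * (⟪k, y - x⟫ : ℂ)) * ft (fun x => (f x : ℂ)) k) := by
        intro k
        rw [hφ, inner_add_right, inner_sub_right, Complex.ofReal_cos, Complex.cos]
        push_cast
        have e1 : Complex.exp (Complex.I * ((⟪k, y⟫ : ℂ) + (⟪k, x⟫ : ℂ))) =
            Complex.exp (Complex.I * (⟪k, y⟫ : ℂ)) * Complex.exp ((⟪k, x⟫ : ℂ) * Complex.I) := by
          rw [← Complex.exp_add]; congr 1; ring
        have e2 : Complex.exp (Complex.I * ((⟪k, y⟫ : ℂ) - (⟪k, x⟫ : ℂ))) =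
            Complex.exp (Complex.I * (⟪k, y⟫ : ℂ)) * Complex.exp (-(⟪k, x⟫ : ℂ) * Complex.I) := by
          rw [← Complex.exp_add]; congr 1; ring
        rw [e1, e2]
        ring
      simp only [e]
      rw [integral_const_mul, integral_add (hi _) (hi _), z1, z2]
      simp
    · have hint : Integrable (fun z : V3 × V3 => ‖φ z.1‖)
          (volume.prod (volume.restrict (Metric.ball (0 : V3) σ))) := hφi.norm.comp_fst _
      refine hint.mono' ?_ (Eventually.of_forall fun z => ?_)
      · have h2 : AEStronglyMeasurable (fun z : V3 × V3 => φ z.1)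
          (volume.prod (volume.restrict (Metric.ball (0 : V3) σ))) := hφi.1.comp_fst
        refine AEStronglyMeasurable.mul ?_ h2
        exact Continuous.aestronglyMeasurable (by fun_prop)
      · simp only [Function.uncurry]
        rw [norm_mul, Complex.norm_real]
        exact mul_le_of_le_one_left (norm_nonneg _) (Real.abs_cos_le_one _)

/-! ### Assembly -/

lemma im_deriv (g : ℝ → ℂ) (g' z : ℂ) (t ε s : ℝ) (h : HasDerivAt g g' (t + ε * s)) :
    HasDerivAt (fun s => (g (t + ε * s) * z).im) (ε * (g' * z).im) s := by
  have h1 : HasDerivAt (fun s : ℝ => t + ε * s) ε s := by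
    simpa using ((hasDerivAt_id s).const_mul ε).const_add t
  have h2 : HasDerivAt (fun s : ℝ => g (t + ε * s) * z) (ε • g' * z) s :=
    (HasDerivAt.scomp s h h1).mul_const z
  have h3 := Complex.imCLM.hasFDerivAt.comp_hasDerivAt s h2
  refine HasDerivAt.congr_deriv (f := fun s => (g (t + ε * s) * z).im) h3 ?_
  rw [Complex.imCLM_apply, smul_mul_assoc, Complex.smul_im, smul_eq_mul]

lemma meas_two {Ω : Type*} [MeasurableSpace Ω] {g : ℝ → ℝ → ℂ}
    (hg : Measurable fun p : ℝ × ℝ => g p.1 p.2) {a b : Ω → ℝ} (ha : Measurable a) (hb : Measurable b) :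
    Measurable fun x => g (a x) (b x) := hg.comp (ha.prodMk hb)

lemma mode_term (m R C : ℝ)
    (hC : ∀ t k, 0 < t → 0 < k → (modeWD m R t k * (starRingEnd ℂ) (modeW m R t k)).im = C)
    (f : V3 → ℝ) (hf : ContDiff ℝ (⊤ : ℕ∞) f) (hfc : HasCompactSupport f) (y : V3) (d : ℝ)
    (hd : ∀ x, dist x y < d → f x = 0) (t₁ t₂ c c' : ℝ) (ht₁ : 0 < t₁) (ht₂ : 0 < t₂)
    (htd : |t₂ - t₁| < d) :
    Integrable (fun k : V3 => ((modeW m R t₂ ‖k‖ * (starRingEnd ℂ) (c * modeW m R t₁ ‖k‖ +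
        c' * modeWD m R t₁ ‖k‖)).im : ℂ) *
        (Complex.exp (Complex.I * (⟪k, y⟫ : ℂ)) * ft (fun x => (f x : ℂ)) k)) ∧
    ∫ k : V3, ((modeW m R t₂ ‖k‖ * (starRingEnd ℂ) (c * modeW m R t₁ ‖k‖ +
        c' * modeWD m R t₁ ‖k‖)).im : ℂ) *
        (Complex.exp (Complex.I * (⟪k, y⟫ : ℂ)) * ft (fun x => (f x : ℂ)) k) = 0 := by
  obtain ⟨hφi, hcos⟩ := cos_prop f hf hfc y d hd _ rfl
  obtain ⟨ε, hε2, hεt, hεm⟩ : ∃ ε : ℝ, ε ^ 2 = 1 ∧ t₁ + ε * |t₂ - t₁| = t₂ ∧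
      ∀ s ∈ Set.Icc 0 |t₂ - t₁|, min t₁ t₂ ≤ t₁ + ε * s := by
    rcases le_total t₁ t₂ with h | h
    · refine ⟨1, by norm_num, ?_, ?_⟩
      · rw [abs_of_nonneg (by linarith)]; ring
      · intro s hs
        rw [min_eq_left h]; linarith [hs.1]
    · refine ⟨-1, by norm_num, ?_, ?_⟩
      · rw [abs_of_nonpos (by linarith)]; ring
      · intro s hs
        rw [abs_of_nonpos (by linarith)] at hs
        rw [min_eq_right h]; linarith [hs.2]
  have hmin : 0 < min t₁ t₂ := lt_min ht₁ ht₂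
  obtain ⟨M, hM⟩ : ∃ M, M = modeMu m R ^ 2 + 1 / 4 := ⟨_, rfl⟩
  have hM0 : 0 ≤ M := by rw [hM]; positivity
  let Z : V3 → ℂ := fun k => (starRingEnd ℂ) (c * modeW m R t₁ ‖k‖ + c' * modeWD m R t₁ ‖k‖)
  have hWm := modeW_measurable m R
  have hWDm := modeWD_measurable m R
  have hZm : Measurable Z := by
    have h1 : Measurable fun k : V3 => modeW m R t₁ ‖k‖ :=
      meas_two (g := modeW m R) hWm measurable_const measurable_norm
    have h2 : Measurable fun k : V3 => modeWD m R t₁ ‖k‖ :=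
      meas_two (g := modeWD m R) hWDm measurable_const measurable_norm
    have h3 : Measurable fun k : V3 => (c : ℂ) * modeW m R t₁ ‖k‖ + c' * modeWD m R t₁ ‖k‖ :=
      (h1.const_mul _).add (h2.const_mul _)
    exact Complex.continuous_conj.measurable.comp h3
  let Y : V3 → ℝ → ℝ := fun k s => (modeW m R (t₁ + ε * s) ‖k‖ * Z k).im
  let Y' : V3 → ℝ → ℝ := fun k s => ε * (modeWD m R (t₁ + ε * s) ‖k‖ * Z k).im
  have hK0 : ∀ᵐ k : V3, 0 < ‖k‖ := by
    have : ∀ᵐ k : V3, k ≠ 0 := by simp [ae_iff]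
    filter_upwards [this] with k hk
    exact norm_pos_iff.2 hk
  have hqm : Measurable fun s : ℝ => M / (t₁ + ε * s) ^ 2 := by fun_prop
  have hqc : ContinuousOn (fun s : ℝ => M / (t₁ + ε * s) ^ 2) (Set.Icc 0 |t₂ - t₁|) := by
    refine ContinuousOn.div (by fun_prop) (by fun_prop) fun s hs => ?_
    have := hmin.trans_le (hεm s hs)
    positivity
  have hQ : ∀ s ∈ Set.Icc 0 |t₂ - t₁|, |M / (t₁ + ε * s) ^ 2| ≤ M / (min t₁ t₂) ^ 2 := by
    intro s hs
    have h1 := hεm s hs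
    have h2 := hmin.trans_le h1
    rw [abs_of_nonneg (by positivity)]
    gcongr
  have hYm : Measurable (Function.uncurry Y) := by
    have h1 : Measurable fun p : V3 × ℝ => modeW m R (t₁ + ε * p.2) ‖p.1‖ :=
      meas_two (g := modeW m R) hWm (by fun_prop) (by fun_prop)
    have h2 : Measurable fun p : V3 × ℝ => Z p.1 := hZm.comp measurable_fst
    exact Complex.measurable_im.comp (h1.mul h2)
  have hY0 : ∀ k : V3, 0 < ‖k‖ → Y k 0 = -(c' * C) := by
    intro k hk
    have := hC t₁ ‖k‖ ht₁ hk
    simp only [Complex.mul_im, Complex.conj_re, Complex.conj_im] at this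
    simp only [Y, Z, mul_zero, add_zero, Complex.mul_im, Complex.conj_re, Complex.conj_im, Complex.add_re,
      Complex.add_im, Complex.mul_re, Complex.ofReal_re, Complex.ofReal_im]
    linear_combination (-c') * this
  have hY'0 : ∀ k : V3, 0 < ‖k‖ → Y' k 0 = ε * (c * C) := by
    intro k hk
    have := hC t₁ ‖k‖ ht₁ hk
    simp only [Complex.mul_im, Complex.conj_re, Complex.conj_im] at this
    simp only [Y', Z, mul_zero, add_zero, Complex.mul_im, Complex.conj_re, Complex.conj_im, Complex.add_re,
      Complex.add_im, Complex.mul_re, Complex.ofReal_re, Complex.ofReal_im]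
    linear_combination (ε * c) * this
  have hYd : ∀ k : V3, 0 < ‖k‖ → ∀ s ∈ Set.Icc 0 |t₂ - t₁|, HasDerivAt (Y k) (Y' k s) s := by
    intro k hk s hs
    exact im_deriv (fun t => modeW m R t ‖k‖) _ (Z k) t₁ ε s
      (modeW_hasDerivAt m R _ _ (hmin.trans_le (hεm s hs)) hk)
  have hYd' : ∀ k : V3, 0 < ‖k‖ → ∀ s ∈ Set.Icc 0 |t₂ - t₁|,
      HasDerivAt (Y' k) (-(‖k‖ ^ 2 + M / (t₁ + ε * s) ^ 2) * Y k s) s := by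
    intro k hk s hs
    have h1 := (im_deriv (fun t => modeWD m R t ‖k‖) _ (Z k) t₁ ε s
      (modeWD_hasDerivAt m R _ _ (hmin.trans_le (hεm s hs)) hk)).const_mul ε
    refine HasDerivAt.congr_deriv (f := Y' k) h1 ?_
    rw [mul_assoc, ← Complex.ofReal_neg, Complex.im_ofReal_mul, ← hM]
    simp only [Y]
    linear_combination (-(‖k‖ ^ 2 + M / (t₁ + ε * s) ^ 2) * (modeW m R (t₁ + ε * s) ‖k‖ * Z k).im) * hε2
  have main := speed_core volume _ hφi (fun k : V3 => ‖k‖) measurable_norm hK0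
    |t₂ - t₁| d (M / (min t₁ t₂) ^ 2) (-(c' * C)) (ε * (c * C)) (abs_nonneg _) htd (by positivity)
    hcos (fun s => M / (t₁ + ε * s) ^ 2) hqm hqc hQ Y Y' hYm hY0 hY'0 hYd hYd'
  simp only [Y, hεt] at main
  exact main

lemma modeV'_eq (m R t k : ℝ) (ht : 0 < t) (hk : 0 < k) :
    modeV' m R t k = modeW m R t k + t * modeWD m R t k := by
  have h1 : HasDerivAt (fun s : ℝ => (s : ℂ) * modeW m R s k)
      (1 * modeW m R t k + t * modeWD m R t k) t :=
    ((hasDerivAt_id t).ofReal_comp.congr_deriv (by simp)).mul (modeW_hasDerivAt m R t k ht hk)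
  have h2 : (fun s => modeV m R s k) =ᶠ[nhds t] fun s : ℝ => (s : ℂ) * modeW m R s k := by
    filter_upwards [Ioi_mem_nhds ht] with s hs
    exact modeV_eq m R s k hs
  rw [modeV', h2.deriv_eq, h1.deriv, one_mul]

lemma conj_diff (v z : ℂ) : v * (starRingEnd ℂ) z - (starRingEnd ℂ) v * z =
    2 * Complex.I * ((v * (starRingEnd ℂ) z).im : ℂ) := by
  apply Complex.ext <;> simp <;> ring

/-- finite propagation speed: if the Cauchy data at time `t₁` are supported
in a compact set `X`, then `u(t₂,y⃗) = 0` whenever `dist(y⃗, X) > |t₂ − t₁|`. -/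
theorem finite_propagation_speed (m R : ℝ) (hm : 0 < m) (hR : 0 < R) (hmR : 3 / 2 < m * R)
    (f h : V3 → ℝ) (hf : ContDiff ℝ (⊤ : ℕ∞) f) (hh : ContDiff ℝ (⊤ : ℕ∞) h)
    (hfc : HasCompactSupport f) (hhc : HasCompactSupport h)
    (X : Set V3) (hX : IsCompact X) (hsupp : tsupport f ∪ tsupport h ⊆ X)
    (t₁ : ℝ) (ht₁ : 0 < t₁) :
    ∀ t₂ : ℝ, 0 < t₂ → ∀ y : V3, |t₂ - t₁| < Metric.infDist y X →
      uSol m R (ktFun m R t₁ f h) t₂ y = 0 := by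
  intro t₂ ht₂ y hty
  obtain ⟨C, hC⟩ := modeW_wronskian m R
  have hdf : ∀ x, dist x y < Metric.infDist y X → x ∉ tsupport f ∪ tsupport h := by
    intro x hx hmem
    have := Metric.infDist_le_dist_of_mem (x := y) (hsupp hmem)
    rw [dist_comm] at this
    linarith
  obtain ⟨iA, zA⟩ := mode_term m R C hC f hf hfc y _ (fun x hx =>
    image_eq_zero_of_notMem_tsupport fun hx' => hdf x hx (Or.inl hx')) t₁ t₂ 1 t₁ ht₁ ht₂ hty
  obtain ⟨iB, zB⟩ := mode_term m R C hC h hh hhc y _ (fun x hx =>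
    image_eq_zero_of_notMem_tsupport fun hx' => hdf x hx (Or.inr hx')) t₁ t₂ t₁ 0 ht₁ ht₂ hty
  rw [uSol]
  have hsum := integral_sub
    (iA.const_mul (((Real.pi : ℂ) * Complex.I / (4 * (t₁ : ℂ) ^ 3)) * (2 * Complex.I * t₂ * t₁)))
    (iB.const_mul (((Real.pi : ℂ) * Complex.I / (4 * (t₁ : ℂ) ^ 3)) * (2 * Complex.I * t₂ * R)))
  rw [integral_const_mul, integral_const_mul, zA, zB, mul_zero, mul_zero, sub_zero] at hsum
  rw [mul_eq_zero]
  right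
  rw [← hsum]
  refine integral_congr_ae ?_
  have hne : ∀ᵐ k : V3, k ≠ 0 := by simp [ae_iff]
  filter_upwards [hne] with k hk0
  have hk : 0 < ‖k‖ := norm_pos_iff.2 hk0
  simp only [ktFun, ktAux, norm_neg, map_mul, map_sub, Complex.conj_conj, ft_conj, Complex.conj_ofReal]
  have hκ : (starRingEnd ℂ) ((Real.pi : ℂ) * Complex.I / (4 * (t₁ : ℂ) ^ 3)) =
      -((Real.pi : ℂ) * Complex.I / (4 * (t₁ : ℂ) ^ 3)) := by
    simp [neg_div, map_ofNat (starRingEnd ℂ) 4]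
  rw [hκ, modeV'_eq m R t₁ ‖k‖ ht₁ hk, modeV_eq m R t₁ ‖k‖ ht₁, modeV_eq m R t₂ ‖k‖ ht₂]
  have dA := conj_diff (modeW m R t₂ ‖k‖) (((1 : ℝ) : ℂ) * modeW m R t₁ ‖k‖ + t₁ * modeWD m R t₁ ‖k‖)
  have dB := conj_diff (modeW m R t₂ ‖k‖) (t₁ * modeW m R t₁ ‖k‖ + ((0 : ℝ) : ℂ) * modeWD m R t₁ ‖k‖)
  have eA : ((1 : ℝ) : ℂ) * modeW m R t₁ ‖k‖ + t₁ * modeWD m R t₁ ‖k‖ =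
    modeW m R t₁ ‖k‖ + t₁ * modeWD m R t₁ ‖k‖ := by simp
  have eB : (t₁ : ℂ) * modeW m R t₁ ‖k‖ + ((0 : ℝ) : ℂ) * modeWD m R t₁ ‖k‖ =
    t₁ * modeW m R t₁ ‖k‖ := by simp
  rw [eA] at dA ⊢
  rw [eB] at dB ⊢
  rw [map_mul (starRingEnd ℂ) (t₂ : ℂ), Complex.conj_ofReal]
  generalize modeW m R t₁ ‖k‖ + t₁ * modeWD m R t₁ ‖k‖ = a at *
  generalize (t₁ : ℂ) * modeW m R t₁ ‖k‖ = b at *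
  generalize modeW m R t₂ ‖k‖ = w at *
  generalize Complex.exp (Complex.I * (⟪k, y⟫ : ℂ)) = e at *
  generalize (Real.pi : ℂ) * Complex.I / (4 * (t₁ : ℂ) ^ 3) = κ at *
  generalize ft (fun x => (f x : ℂ)) k = F at *
  generalize ft (fun x => (h x : ℂ)) k = H at *
  linear_combination (e * κ * t₂ * t₁ * F) * dA - (e * κ * t₂ * R * H) * dB
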